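/- arXiv:math/0503137 — 2 statements merged into one kernel-verified Lean document; each statement's English description precedes it below -/
import Mathlib

section
/- Let T be an infinite, locally finite rooted tree with root o and no leaves except possibly o, with interaction strengths J_v satisfying 0 < J_min ≤ J_v ≤ J_max and inverse temperature β > 0; set θ_v = tanh(β J_v). Assign to the edge from the parent of v to v the resistance R_v = Π_{o < y ≤ v} θ_y^{-1}. Then the sequence P^(N,+)(η(o) = +1) is nonincreasing in N, and its limit equals 1/2 if and only if cap_3(T) = 0. -/
open scoped ENNReal Classical

noncomputable section

/-- Vertices of the canonical rooted tree: finite sequences of naturals; the root is `[]`. -/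
abbrev Vtx := List ℕ

/-- Vertices of the tree determined by the child-count function `c`. -/
inductive IsVtx (c : Vtx → ℕ) : Vtx → Prop
  | root : IsVtx c []
  | child {v : Vtx} {i : ℕ} : IsVtx c v → i < c v → IsVtx c (v ++ [i])

/-- A flow: conservation at every non-root, non-leaf vertex (edges are identified with their
lower endpoints). -/
def IsFlow (c : Vtx → ℕ) (μ : Vtx → ℝ≥0∞) : Prop :=
  ∀ v : Vtx, IsVtx c v → v ≠ [] → c v ≠ 0 →
    μ v = ∑ i ∈ Finset.range (c v), μ (v ++ [i])

/-- Total flow out of the root. -/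
def flowMass (c : Vtx → ℕ) (μ : Vtx → ℝ≥0∞) : ℝ≥0∞ :=
  ∑ i ∈ Finset.range (c []), μ [i]

/-- An infinite ray from the root. -/
def IsRay (c : Vtx → ℕ) (y : ℕ → ℕ) : Prop :=
  ∀ n : ℕ, y n < c ((List.range n).map y)

/-- `V_μ(y) = Σ_{e ∈ y} (μ(e) R(e))^s` along an infinite ray. -/
def rayPot (μ R : Vtx → ℝ≥0∞) (s : ℝ) (y : ℕ → ℕ) : ℝ≥0∞ :=
  ∑' n : ℕ, (μ ((List.range (n + 1)).map y) * R ((List.range (n + 1)).map y)) ^ s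

/-- `V_μ` along the maximal path from the root to a leaf `ℓ`. -/
def leafPot (μ R : Vtx → ℝ≥0∞) (s : ℝ) (ℓ : Vtx) : ℝ≥0∞ :=
  ∑ k ∈ Finset.range ℓ.length, (μ (ℓ.take (k + 1)) * R (ℓ.take (k + 1))) ^ s

/-- `cap_p` of an infinite leafless tree. -/
def capInf (c : Vtx → ℕ) (R : Vtx → ℝ≥0∞) (p : ℝ) : ℝ≥0∞ :=
  sSup {m | ∃ μ : Vtx → ℝ≥0∞, IsFlow c μ ∧
    (∀ y : ℕ → ℕ, IsRay c y → rayPot μ R (p - 1) y ≤ 1) ∧ m = flowMass c μ}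

/-- `cap_p` of a finite tree. -/
def capFin (c : Vtx → ℕ) (R : Vtx → ℝ≥0∞) (p : ℝ) : ℝ≥0∞ :=
  sSup {m | ∃ μ : Vtx → ℝ≥0∞, IsFlow c μ ∧
    (∀ ℓ : Vtx, IsVtx c ℓ → c ℓ = 0 → leafPot μ R (p - 1) ℓ ≤ 1) ∧ m = flowMass c μ}

/-- The set of vertices at distance `n` from the root. -/
def lev (c : Vtx → ℕ) : ℕ → Finset Vtx
  | 0 => {([] : Vtx)}
  | n + 1 => (lev c n).biUnion fun v => (Finset.range (c v)).image fun i => v ++ [i]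

/-- The vertices of the truncated tree `T^(N)`. -/
def verts (c : Vtx → ℕ) (N : ℕ) : Finset Vtx := (Finset.range (N + 1)).biUnion (lev c)

/-- Spin configurations on `T^(N)`. -/
def Conf (c : Vtx → ℕ) (N : ℕ) := {v // v ∈ verts c N} → Bool

instance (c : Vtx → ℕ) (N : ℕ) : Fintype (Conf c N) := by unfold Conf; infer_instance

/-- The ±1 spin of a configuration at a vertex. -/
def spin (c : Vtx → ℕ) (N : ℕ) (σ : Conf c N) (w : Vtx) : ℝ :=
  if h : w ∈ verts c N then (if σ ⟨w, h⟩ then 1 else -1) else 1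

/-- The weight `W(η) = Π_{v → w} exp(β J_w η(v) η(w))` of a configuration on `T^(N)`. -/
def wt (c : Vtx → ℕ) (J : Vtx → ℝ) (β : ℝ) (N : ℕ) (σ : Conf c N) : ℝ :=
  ∏ w ∈ (Finset.range N).biUnion (fun n => lev c (n + 1)),
    Real.exp (β * J w * spin c N σ w.dropLast * spin c N σ w)

/-- `P^(N,+)(η(o) = +1)`: probability of a plus spin at the root under plus boundary
conditions at level `N`. -/
def plusProb (c : Vtx → ℕ) (J : Vtx → ℝ) (β : ℝ) (N : ℕ) : ℝ :=
  (∑ σ : Conf c N, if (∀ x : {v // v ∈ verts c N}, x.1 ∈ lev c N → σ x = true)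
      ∧ spin c N σ [] = 1 then wt c J β N σ else 0) /
  (∑ σ : Conf c N, if (∀ x : {v // v ∈ verts c N}, x.1 ∈ lev c N → σ x = true)
      then wt c J β N σ else 0)

namespace IsingTree

open Real

section Analysis

theorem tanh_eq_exp (y : ℝ) : tanh y = (1 - exp (-(2 * y))) / (1 + exp (-(2 * y))) := by
  rw [tanh_eq_sinh_div_cosh, sinh_eq, cosh_eq]
  have h : exp (-(2 * y)) = exp (-y) * exp (-y) := by rw [← exp_add]; ring_nf
  have h1 : exp y * exp (-y) = 1 := by rw [← exp_add]; simp
  have h2 := exp_pos y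
  have h3 := exp_pos (-y)
  rw [h, div_div_div_cancel_right₀ two_ne_zero, div_eq_div_iff (by positivity) (by positivity)]
  linear_combination (2 * exp (-y)) * h1

theorem tanh_strictMono : StrictMono tanh := fun x y hxy => by
  rw [← artanh_lt_artanh_iff ⟨neg_one_lt_tanh x, tanh_lt_one x⟩ ⟨neg_one_lt_tanh y, tanh_lt_one y⟩,
    artanh_tanh, artanh_tanh]
  exact hxy

theorem tanh_pos' {x : ℝ} (hx : 0 < x) : 0 < tanh x := by
  simpa using tanh_strictMono hx

theorem sq_le_tanh_sq_mul (x : ℝ) (hx : 0 ≤ x) : x ^ 2 ≤ tanh x ^ 2 * (1 + x ^ 2) := by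
  have hc := cosh_pos x
  have h1 := cosh_sq x
  have h2 : x ≤ sinh x := self_le_sinh_iff.2 hx
  rw [tanh_eq_sinh_div_cosh, div_pow, div_mul_eq_mul_div, le_div_iff₀ (by positivity), h1]
  nlinarith

theorem hasDerivAt_tanh' (x : ℝ) : HasDerivAt tanh (1 - tanh x ^ 2) x := by
  have hc := cosh_pos x
  have h := (hasDerivAt_sinh x).div (hasDerivAt_cosh x) hc.ne'
  have he : tanh = fun y => sinh y / cosh y := funext tanh_eq_sinh_div_cosh
  rw [he]
  refine h.congr_deriv ?_
  field_simp

theorem tanh_add_cube_le {x : ℝ} (hx : 0 ≤ x) : tanh x + tanh x ^ 3 / 3 ≤ x := by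
  have hd : ∀ y, HasDerivAt (fun y => y - (tanh y + tanh y ^ 3 / 3)) (tanh y ^ 4) y := fun y => by
    have h := hasDerivAt_tanh' y
    refine ((hasDerivAt_id y).sub (h.add ((h.pow 3).div_const 3))).congr_deriv ?_
    simp only [Nat.cast_ofNat, Nat.add_one_sub_one]
    ring
  have hm : Monotone (fun y => y - (tanh y + tanh y ^ 3 / 3)) :=
    monotone_of_deriv_nonneg (fun y => (hd y).differentiableAt) fun y => by
      rw [(hd y).deriv]; positivity
  have := hm hx
  simp at this
  linarith

theorem cube_mul_cosh_le {u : ℝ} (hu : 0 ≤ u) : u ^ 3 * cosh u ≤ sinh u ^ 3 := by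
  have hd : ∀ y, HasDerivAt (fun y => sinh y * cosh y ^ (-(1 / 3) : ℝ) - y)
      (cosh y * cosh y ^ (-(1 / 3) : ℝ) +
        sinh y * (sinh y * (-(1 / 3)) * cosh y ^ (-(1 / 3) - 1 : ℝ)) - 1) y := fun y =>
    ((hasDerivAt_sinh y).mul ((hasDerivAt_cosh y).rpow_const (Or.inl (cosh_pos y).ne'))).sub
      (hasDerivAt_id y)
  have hm : Monotone (fun y => sinh y * cosh y ^ (-(1 / 3) : ℝ) - y) :=
    monotone_of_deriv_nonneg (fun y => (hd y).differentiableAt) fun y => by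
      rw [(hd y).deriv]
      have hc := cosh_pos y
      obtain ⟨a, ha, hac⟩ : ∃ a : ℝ, 0 < a ∧ a ^ 3 = cosh y :=
        ⟨cosh y ^ (1 / 3 : ℝ), by positivity, by
          rw [← rpow_natCast, ← rpow_mul hc.le]; norm_num⟩
      have e1 : cosh y ^ (-(1 / 3) : ℝ) = a⁻¹ := by
        rw [← hac, ← rpow_natCast, ← rpow_mul ha.le, ← rpow_neg_one]; norm_num
      have e2 : cosh y ^ (-(1 / 3) - 1 : ℝ) = (a ^ 4)⁻¹ := by
        rw [← hac, ← rpow_natCast, ← rpow_mul ha.le, ← rpow_natCast, ← rpow_neg ha.le]; norm_num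
      have hs : sinh y ^ 2 = a ^ 6 - 1 := by
        have := cosh_sq y
        rw [← hac] at this
        linear_combination -this
      have : cosh y * cosh y ^ (-(1 / 3) : ℝ) +
        sinh y * (sinh y * (-(1 / 3)) * cosh y ^ (-(1 / 3) - 1 : ℝ)) - 1
          = (a ^ 2 - 1) ^ 2 * (2 * a ^ 2 + 1) / (3 * a ^ 4) := by
        rw [e1, e2, ← hac]
        field_simp
        linear_combination -hs
      rw [this]
      positivity
  have hc := cosh_pos u
  have h0 : u ≤ sinh u * cosh u ^ (-(1 / 3) : ℝ) := by
    have := hm hu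
    simp at this
    simpa using this
  have h1 := pow_le_pow_left₀ hu h0 3
  have e : (cosh u ^ (-(1 / 3) : ℝ)) ^ 3 = (cosh u)⁻¹ := by
    rw [← rpow_natCast, ← rpow_mul hc.le, ← rpow_neg_one]; norm_num
  rw [mul_pow, e, ← div_eq_mul_inv, le_div_iff₀ hc] at h1
  exact h1

theorem inv_sinh_sq_sub_monotoneOn :
    MonotoneOn (fun u => (sinh u ^ 2)⁻¹ - (u ^ 2)⁻¹) (Set.Ioi 0) := by
  have hd : ∀ u ∈ Set.Ioi (0 : ℝ), HasDerivAt (fun u => (sinh u ^ 2)⁻¹ - (u ^ 2)⁻¹)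
      (2 / u ^ 3 - 2 * cosh u / sinh u ^ 3) u := fun u hu => by
    have hu : 0 < u := hu
    have hs : 0 < sinh u := sinh_pos_iff.2 hu
    refine ((((hasDerivAt_sinh u).pow 2).inv (pow_ne_zero 2 hs.ne')).sub
      (((hasDerivAt_id u).pow 2).inv (by simpa using hu.ne'))).congr_deriv ?_
    simp
    field_simp
    ring
  refine monotoneOn_of_deriv_nonneg (convex_Ioi 0)
    (fun u hu => (hd u hu).continuousAt.continuousWithinAt)
    (fun u hu => (hd u (interior_subset hu)).differentiableAt.differentiableWithinAt) ?_
  intro u hu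
  have hu : u ∈ Set.Ioi (0 : ℝ) := interior_subset hu
  rw [(hd u hu).deriv]
  have hu : 0 < u := hu
  have hs : 0 < sinh u := sinh_pos_iff.2 hu
  rw [sub_nonneg, div_le_div_iff₀ (by positivity) (by positivity)]
  linarith [cube_mul_cosh_le hu.le]

theorem inv_tanh_sq {u : ℝ} (hu : 0 < u) : (tanh u ^ 2)⁻¹ = 1 + (sinh u ^ 2)⁻¹ := by
  have hs : 0 < sinh u := sinh_pos_iff.2 hu
  rw [tanh_eq_sinh_div_cosh, div_pow, inv_div, cosh_sq]
  field_simp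

theorem two_fifths_le {x : ℝ} (hx : 0 < x) : 2 / 5 ≤ (tanh x ^ 2)⁻¹ - (x ^ 2)⁻¹ := by
  have ht := tanh_pos' hx
  have ht1 := tanh_lt_one x
  have h := tanh_add_cube_le hx.le
  have h2 : (tanh x + tanh x ^ 3 / 3) ^ 2 ≤ x ^ 2 := pow_le_pow_left₀ (by positivity) h 2
  have h3 : (x ^ 2)⁻¹ ≤ ((tanh x + tanh x ^ 3 / 3) ^ 2)⁻¹ := by gcongr
  refine le_trans ?_ (sub_le_sub_left h3 _)
  set y := tanh x
  have : (y ^ 2)⁻¹ - ((y + y ^ 3 / 3) ^ 2)⁻¹ = ((1 + y ^ 2 / 3) ^ 2 - 1) / (y + y ^ 3 / 3) ^ 2 := by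
    field_simp
  rw [this, le_div_iff₀ (by positivity)]
  have hy2 : y ^ 2 ≤ 1 := by nlinarith
  have hy4 : 0 ≤ y ^ 2 := sq_nonneg _
  nlinarith [mul_nonneg hy4 (sub_nonneg.2 hy2), mul_nonneg (mul_nonneg hy4 hy4) (sub_nonneg.2 hy2)]

/-- The effective field sent through an edge of strength `K` by a vertex with field `X`. -/
def msg (K X : ℝ) : ℝ := (log (cosh (X + K)) - log (cosh (X - K))) / 2

theorem continuous_msg (K : ℝ) : Continuous (msg K) := by
  unfold msg
  have h : ∀ a : ℝ, Continuous fun X => log (cosh (X + a)) := fun a =>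
    (continuous_cosh.comp (continuous_add_const a)).log fun X => (cosh_pos _).ne'
  simpa [sub_eq_add_neg] using ((h K).sub (h (-K))).div_const 2

theorem exp_msg (K X : ℝ) : exp (-(2 * msg K X)) = cosh (X - K) / cosh (X + K) := by
  have : -(2 * msg K X) = log (cosh (X - K)) - log (cosh (X + K)) := by unfold msg; ring
  rw [this, exp_sub, exp_log (cosh_pos _), exp_log (cosh_pos _)]

theorem tanh_msg (K X : ℝ) : tanh (msg K X) = tanh K * tanh X := by
  have h1 := cosh_pos K
  have h2 := cosh_pos X
  have h3 := cosh_pos (X + K)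
  have h4 := cosh_pos (X - K)
  rw [tanh_eq_exp, exp_msg, tanh_eq_sinh_div_cosh, tanh_eq_sinh_div_cosh]
  have : (1 - cosh (X - K) / cosh (X + K)) / (1 + cosh (X - K) / cosh (X + K)) =
      (cosh (X + K) - cosh (X - K)) / (cosh (X + K) + cosh (X - K)) := by
    field_simp
  rw [this, cosh_add, cosh_sub]
  have h5 : cosh X * cosh K + sinh X * sinh K + (cosh X * cosh K - sinh X * sinh K) =
    2 * (cosh X * cosh K) := by ring
  rw [h5]
  field_simp
  ring

theorem msg_zero (K : ℝ) : msg K 0 = 0 := by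
  simp [msg]

theorem msg_mono {K : ℝ} (hK : 0 < K) : Monotone (msg K) := fun X Y h => by
  rw [← tanh_strictMono.le_iff_le, tanh_msg, tanh_msg]
  exact mul_le_mul_of_nonneg_left (tanh_strictMono.monotone h) (tanh_pos' hK).le

theorem msg_nonneg {K X : ℝ} (hK : 0 < K) (hX : 0 ≤ X) : 0 ≤ msg K X := by
  simpa [msg_zero] using msg_mono hK hX

theorem msg_le {K X : ℝ} (hK : 0 < K) : msg K X ≤ K := by
  rw [← tanh_strictMono.le_iff_le, tanh_msg]
  have := tanh_pos' hK
  nlinarith [tanh_lt_one X]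

theorem tanh_le_self' {x : ℝ} (hx : 0 ≤ x) : tanh x ≤ x := by
  have h1 := tanh_add_cube_le hx
  have h2 : 0 ≤ tanh x := by simpa using tanh_strictMono.monotone hx
  have : 0 ≤ tanh x ^ 3 := by positivity
  linarith

theorem le_msg_sq {K X : ℝ} (hK : 0 < K) (hX : 0 ≤ X) :
    tanh K ^ 2 * X ^ 2 ≤ msg K X ^ 2 * (1 + X ^ 2) := by
  have h0 := msg_nonneg hK hX
  have h1 : tanh (msg K X) ≤ msg K X := tanh_le_self' h0
  have h2 : 0 ≤ tanh (msg K X) := by simpa using tanh_strictMono.monotone h0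
  have h3 : tanh (msg K X) ^ 2 ≤ msg K X ^ 2 := pow_le_pow_left₀ h2 h1 2
  calc tanh K ^ 2 * X ^ 2 ≤ tanh K ^ 2 * (tanh X ^ 2 * (1 + X ^ 2)) := by
        gcongr; exact sq_le_tanh_sq_mul X hX
    _ = tanh (msg K X) ^ 2 * (1 + X ^ 2) := by rw [tanh_msg]; ring
    _ ≤ _ := by gcongr

theorem msg_sq_le {K X : ℝ} (hK : 0 < K) (hX : 0 ≤ X) :
    msg K X ^ 2 * (1 + 2 / 5 * (1 - tanh K ^ 2) * X ^ 2) ≤ tanh K ^ 2 * X ^ 2 := by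
  rcases hX.eq_or_lt with rfl | hX
  · simp [msg_zero]
  have hθ := tanh_pos' hK
  have hθ1 := tanh_lt_one K
  have htX := tanh_pos' hX
  have hu : 0 < msg K X := by
    rw [← tanh_strictMono.lt_iff_lt, tanh_msg, tanh_zero]; positivity
  have huX : msg K X ≤ X := by
    rw [← tanh_strictMono.le_iff_le, tanh_msg]
    nlinarith
  have hF := inv_sinh_sq_sub_monotoneOn (Set.mem_Ioi.2 hu) (Set.mem_Ioi.2 hX) huX
  have e1 := inv_tanh_sq hu
  have e2 := inv_tanh_sq hX
  have e3 := two_fifths_le hX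
  have e4 : tanh K ^ 2 * (tanh (msg K X) ^ 2)⁻¹ = (tanh X ^ 2)⁻¹ := by
    rw [tanh_msg]; field_simp
  set u := msg K X
  simp only at hF
  have hθ2 : tanh K ^ 2 ≤ 1 := by nlinarith
  have key : 2 / 5 * (1 - tanh K ^ 2) ≤ tanh K ^ 2 * (u ^ 2)⁻¹ - (X ^ 2)⁻¹ := by
    have h1 : (tanh u ^ 2)⁻¹ - (u ^ 2)⁻¹ ≤ (tanh X ^ 2)⁻¹ - (X ^ 2)⁻¹ := by
      rw [e1, e2]; linarith
    nlinarith [mul_le_mul_of_nonneg_left h1 (sq_nonneg (tanh K)),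
      mul_le_mul_of_nonneg_left e3 (sub_nonneg.2 hθ2)]
  have := mul_le_mul_of_nonneg_right key (show 0 ≤ u ^ 2 * X ^ 2 by positivity)
  have e5 : (tanh K ^ 2 * (u ^ 2)⁻¹ - (X ^ 2)⁻¹) * (u ^ 2 * X ^ 2) =
      tanh K ^ 2 * X ^ 2 - u ^ 2 := by field_simp
  rw [e5] at this
  linarith

end Analysis

section Partition

theorem length_of_mem_lev {c : Vtx → ℕ} {n : ℕ} {v : Vtx} (h : v ∈ lev c n) : v.length = n := by
  induction n generalizing v with
  | zero => simp_all [lev]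
  | succ n ih =>
    simp only [lev, Finset.mem_biUnion, Finset.mem_image] at h
    obtain ⟨u, hu, i, -, rfl⟩ := h
    simp [ih hu]

theorem prod_lev_succ (c : Vtx → ℕ) (n : ℕ) (f : Vtx → ℝ) :
    ∏ w ∈ lev c (n + 1), f w = ∏ v ∈ lev c n, ∏ i ∈ Finset.range (c v), f (v ++ [i]) := by
  rw [lev, Finset.prod_biUnion]
  · refine Finset.prod_congr rfl fun v _ => Finset.prod_image ?_
    intro i _ j _ h
    simpa using h
  · intro v _ u _ hvu
    refine Finset.disjoint_left.2 fun w hw hw' => hvu ?_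
    simp only [Finset.mem_image] at hw hw'
    obtain ⟨i, -, rfl⟩ := hw
    obtain ⟨j, -, h⟩ := hw'
    simpa using (congrArg List.dropLast h).symm

theorem verts_succ (c : Vtx → ℕ) (n : ℕ) : verts c (n + 1) = verts c n ∪ lev c (n + 1) := by
  rw [verts, Finset.range_add_one, Finset.biUnion_insert, Finset.union_comm]
  rfl

theorem length_le_of_mem_verts {c : Vtx → ℕ} {n : ℕ} {v : Vtx} (h : v ∈ verts c n) :
    v.length ≤ n := by
  simp only [verts, Finset.mem_biUnion, Finset.mem_range] at h
  obtain ⟨k, hk, hv⟩ := h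
  rw [length_of_mem_lev hv]
  omega

theorem disjoint_verts_lev (c : Vtx → ℕ) (n : ℕ) : Disjoint (verts c n) (lev c (n + 1)) :=
  Finset.disjoint_left.2 fun v hv hv' => by
    have := length_le_of_mem_verts hv
    have := length_of_mem_lev hv'
    omega

/-- The spin value of a Boolean. -/
def sgn (b : Bool) : ℝ := if b then 1 else -1

/-- The weight of the configuration `η` on the first `N` generations of edges. -/
def weight (c : Vtx → ℕ) (J : Vtx → ℝ) (β : ℝ) (N : ℕ) (η : Vtx → Bool) : ℝ :=
  ∏ n ∈ Finset.range N, ∏ w ∈ lev c (n + 1),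
    Real.exp (β * J w * sgn (η w.dropLast) * sgn (η w))

/-- Extension of a configuration on a finite set of vertices by plus spins. -/
def extend (A : Finset Vtx) (τ : A → Bool) : Vtx → Bool :=
  Function.updateFinset (fun _ => true) A τ

theorem sum_extend_union {A s t : Finset Vtx} (hA : A = s ∪ t) (hst : Disjoint s t)
    (F : (Vtx → Bool) → ℝ) :
    ∑ τ : A → Bool, F (extend A τ) =
      ∑ σ : s → Bool, ∑ ρ : t → Bool, F (Function.updateFinset (extend s σ) t ρ) := by
  subst hA
  rw [← Fintype.sum_prod_type']
  refine (Fintype.sum_equiv (Equiv.piFinsetUnion (fun _ : Vtx => Bool) hst) _ _ ?_).symm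
  rintro ⟨y, z⟩
  simp only [extend]
  rw [Function.updateFinset_updateFinset hst]

/-- One step of the recursion that sums out the spins of the children. -/
def childSum (c : Vtx → ℕ) (J : Vtx → ℝ) (β : ℝ) (h : Vtx → Bool → ℝ) (v : Vtx) (s : Bool) : ℝ :=
  ∏ i ∈ Finset.range (c v), ∑ t : Bool,
    Real.exp (β * J (v ++ [i]) * sgn s * sgn t) * h (v ++ [i]) t

/-- Partition function with boundary field `h` at generation `N` and root field `g`. -/
def total (c : Vtx → ℕ) (J : Vtx → ℝ) (β : ℝ) (N : ℕ) (h : Vtx → Bool → ℝ) (g : Bool → ℝ) : ℝ :=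
  ∑ τ : {v // v ∈ verts c N} → Bool, weight c J β N (extend (verts c N) τ) *
    (∏ x ∈ lev c N, h x (extend (verts c N) τ x)) * g (extend (verts c N) τ [])

theorem total_succ (c : Vtx → ℕ) (J : Vtx → ℝ) (β : ℝ) (N : ℕ) (h : Vtx → Bool → ℝ)
    (g : Bool → ℝ) : total c J β (N + 1) h g = total c J β N (childSum c J β h) g := by
  unfold total
  rw [sum_extend_union (verts_succ c N) (disjoint_verts_lev c N)
    (fun η => weight c J β (N + 1) η * (∏ x ∈ lev c (N + 1), h x (η x)) * g (η []))]
  refine Finset.sum_congr rfl fun σ _ => ?_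
  set η := extend (verts c N) σ
  set L := lev c (N + 1) with hL
  have hlow : ∀ (ρ : L → Bool) (w : Vtx), w.length ≤ N → Function.updateFinset η L ρ w = η w := by
    intro ρ w hw
    have : w ∉ L := fun hmem => by
      have := length_of_mem_lev hmem
      omega
    simp [Function.updateFinset, this]
  have hw : ∀ ρ : L → Bool, weight c J β N (Function.updateFinset η L ρ) = weight c J β N η := by
    intro ρ
    refine Finset.prod_congr rfl fun n hn => Finset.prod_congr rfl fun w hw => ?_
    have h1 := length_of_mem_lev hw
    have h2 := Finset.mem_range.1 hn
    rw [hlow ρ w (by omega), hlow ρ w.dropLast (by simp; omega)]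
  have hterm : ∀ ρ : L → Bool,
      weight c J β (N + 1) (Function.updateFinset η L ρ) *
        (∏ x ∈ L, h x (Function.updateFinset η L ρ x)) * g (Function.updateFinset η L ρ []) =
      weight c J β N η * g (η []) * ∏ x : L,
        (Real.exp (β * J x * sgn (η x.1.dropLast) * sgn (ρ x)) * h x (ρ x)) := by
    intro ρ
    have h1 : weight c J β (N + 1) (Function.updateFinset η L ρ) =
        weight c J β N η * ∏ x : L, Real.exp (β * J x * sgn (η x.1.dropLast) * sgn (ρ x)) := by
      rw [← hw ρ]
      unfold weight
      rw [Finset.prod_range_succ, ← hL, ← Finset.prod_coe_sort L]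
      congr 1
      refine Finset.prod_congr rfl fun x _ => ?_
      have := length_of_mem_lev x.2
      rw [hlow ρ x.1.dropLast (by simp; omega)]
      simp [Function.updateFinset]
    have h2 : ∏ x ∈ L, h x (Function.updateFinset η L ρ x) = ∏ x : L, h x (ρ x) := by
      rw [← Finset.prod_coe_sort L]
      refine Finset.prod_congr rfl fun x _ => ?_
      simp [Function.updateFinset]
    rw [h1, h2, hlow ρ [] (by simp), Finset.prod_mul_distrib]
    ring
  simp only [hterm]
  rw [← Finset.mul_sum]
  have hsum : ∑ ρ : L → Bool, ∏ x : L,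
        (Real.exp (β * J x * sgn (η x.1.dropLast) * sgn (ρ x)) * h x (ρ x)) =
      ∏ x : L, ∑ t : Bool, Real.exp (β * J x * sgn (η x.1.dropLast) * sgn t) * h x t := by
    rw [Finset.prod_univ_sum, Fintype.piFinset_univ]
  rw [hsum, Finset.prod_coe_sort L
    (fun x => ∑ t : Bool, Real.exp (β * J x * sgn (η x.dropLast) * sgn t) * h x t), hL,
    prod_lev_succ]
  simp only [List.dropLast_concat]
  unfold childSum
  ring

theorem total_zero (c : Vtx → ℕ) (J : Vtx → ℝ) (β : ℝ) (h : Vtx → Bool → ℝ) (g : Bool → ℝ) :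
    total c J β 0 h g = ∑ s : Bool, h [] s * g s := by
  have hmem : ([] : Vtx) ∈ verts c 0 := by simp [verts, lev]
  have hval : ∀ x : {v // v ∈ verts c 0}, x = ⟨[], hmem⟩ := fun x =>
    Subtype.ext (List.length_eq_zero_iff.1 (Nat.le_zero.1 (length_le_of_mem_verts x.2)))
  let _ : Unique {v // v ∈ verts c 0} := ⟨⟨⟨[], hmem⟩⟩, hval⟩
  unfold total
  refine Fintype.sum_equiv (Equiv.funUnique _ Bool) _ _ fun τ => ?_
  have : extend (verts c 0) τ [] = τ ⟨[], hmem⟩ := by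
    simp [extend, Function.updateFinset, hmem]
  simp [weight, lev, this]
  rfl

/-- Partition functions of the subtrees of height `n` with plus boundary. -/
def subZ (c : Vtx → ℕ) (J : Vtx → ℝ) (β : ℝ) : ℕ → Vtx → Bool → ℝ
  | 0 => fun _ s => if s then 1 else 0
  | n + 1 => childSum c J β (subZ c J β n)

theorem total_subZ (c : Vtx → ℕ) (J : Vtx → ℝ) (β : ℝ) (N k : ℕ) (g : Bool → ℝ) :
    total c J β N (subZ c J β k) g = ∑ s : Bool, subZ c J β (k + N) [] s * g s := by
  induction N generalizing k with
  | zero => exact total_zero ..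
  | succ N ih =>
    rw [total_succ, show k + (N + 1) = k + 1 + N by ring, ← ih (k + 1)]
    rfl

theorem lev_subset_verts (c : Vtx → ℕ) (N : ℕ) : lev c N ⊆ verts c N := fun x hx =>
  Finset.mem_biUnion.2 ⟨N, by simp, hx⟩

theorem spin_eq (c : Vtx → ℕ) (N : ℕ) (σ : Conf c N) (w : Vtx) :
    spin c N σ w = sgn (extend (verts c N) σ w) := by
  unfold spin sgn extend Function.updateFinset
  split_ifs <;> simp_all

theorem wt_eq (c : Vtx → ℕ) (J : Vtx → ℝ) (β : ℝ) (N : ℕ) (σ : Conf c N) :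
    wt c J β N σ = weight c J β N (extend (verts c N) σ) := by
  unfold wt weight
  rw [Finset.prod_biUnion]
  · simp only [spin_eq]
  · intro a _ b _ hab
    refine Finset.disjoint_left.2 fun v hv hv' => hab ?_
    have := length_of_mem_lev hv
    have := length_of_mem_lev hv'
    omega

theorem prod_boundary (c : Vtx → ℕ) (J : Vtx → ℝ) (β : ℝ) (N : ℕ) (σ : Conf c N) :
    ∏ x ∈ lev c N, subZ c J β 0 x (extend (verts c N) σ x) =
      if ∀ x : {v // v ∈ verts c N}, x.1 ∈ lev c N → σ x = true then 1 else 0 := by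
  have hval : ∀ x : {v // v ∈ verts c N}, extend (verts c N) σ x.1 = σ x := fun x => by
    simp [extend, Function.updateFinset]
  simp only [subZ]
  rw [Finset.prod_ite_zero]
  simp only [Finset.prod_const_one]
  refine if_congr ⟨fun h x hx => ?_, fun h x hx => ?_⟩ rfl rfl
  · rw [← hval]; exact h _ hx
  · rw [hval ⟨x, lev_subset_verts c N hx⟩]; exact h _ hx

theorem plusProb_eq (c : Vtx → ℕ) (J : Vtx → ℝ) (β : ℝ) (N : ℕ) :
    plusProb c J β N =
      subZ c J β N [] true / (subZ c J β N [] true + subZ c J β N [] false) := by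
  have h1 := total_subZ c J β N 0 (fun s => if s then 1 else 0)
  have h2 := total_subZ c J β N 0 (fun _ => 1)
  simp only [Fintype.sum_bool, zero_add, if_true, mul_one, Bool.false_eq_true, if_false, mul_zero,
    add_zero] at h1 h2
  rw [← h2, ← h1]
  unfold plusProb
  refine congrArg₂ (· / ·) (Finset.sum_congr rfl fun σ _ => ?_)
    (Finset.sum_congr rfl fun σ _ => ?_)
  · rw [prod_boundary, spin_eq, wt_eq]
    generalize extend (verts c N) σ [] = b
    cases b <;> norm_num [sgn]
  · rw [prod_boundary, wt_eq]
    simp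

end Partition

section Messages

open Filter Topology

/-- Message sent by `w` to its parent, with plus boundary `n` generations below `w`. -/
def edgeMsg (c : Vtx → ℕ) (K : Vtx → ℝ) : ℕ → Vtx → ℝ
  | 0, w => K w
  | n + 1, w => msg (K w) (∑ i ∈ Finset.range (c w), edgeMsg c K n (w ++ [i]))

/-- Unnormalised message from `w` to a parent of spin `s`. -/
def edgeZ (c : Vtx → ℕ) (J : Vtx → ℝ) (β : ℝ) (n : ℕ) (w : Vtx) (s : Bool) : ℝ :=
  ∑ t : Bool, exp (β * J w * sgn s * sgn t) * subZ c J β n w t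

theorem subZ_succ (c : Vtx → ℕ) (J : Vtx → ℝ) (β : ℝ) (n : ℕ) (w : Vtx) (s : Bool) :
    subZ c J β (n + 1) w s = ∏ i ∈ Finset.range (c w), edgeZ c J β n (w ++ [i]) s := rfl

theorem subZ_succ_ratio {c : Vtx → ℕ} {J : Vtx → ℝ} {β : ℝ} {n : ℕ} {w : Vtx}
    (h : ∀ u, 0 < edgeZ c J β n u true ∧ edgeZ c J β n u false =
      exp (-(2 * edgeMsg c (fun v => β * J v) n u)) * edgeZ c J β n u true) :
    0 < subZ c J β (n + 1) w true ∧ subZ c J β (n + 1) w false =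
      exp (-(2 * ∑ i ∈ Finset.range (c w), edgeMsg c (fun v => β * J v) n (w ++ [i]))) *
        subZ c J β (n + 1) w true := by
  refine ⟨by rw [subZ_succ]; exact Finset.prod_pos fun i _ => (h _).1, ?_⟩
  rw [subZ_succ, subZ_succ, Finset.prod_congr rfl fun i _ => (h (w ++ [i])).2,
    Finset.prod_mul_distrib, ← exp_sum, Finset.sum_neg_distrib, Finset.mul_sum]

theorem edgeZ_ratio (c : Vtx → ℕ) (J : Vtx → ℝ) (β : ℝ) (n : ℕ) (w : Vtx) :
    0 < edgeZ c J β n w true ∧ edgeZ c J β n w false =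
      exp (-(2 * edgeMsg c (fun v => β * J v) n w)) * edgeZ c J β n w true := by
  induction n generalizing w with
  | zero =>
    simp only [edgeZ, subZ, edgeMsg, sgn, Fintype.sum_bool]
    simp only [if_true, Bool.false_eq_true, if_false, mul_one, mul_zero, add_zero]
    refine ⟨exp_pos _, ?_⟩
    rw [← exp_add]
    ring_nf
  | succ n ih =>
    obtain ⟨hpos, hrat⟩ := subZ_succ_ratio (w := w) ih
    simp only [edgeZ, Fintype.sum_bool, edgeMsg]
    set X := ∑ i ∈ Finset.range (c w), edgeMsg c (fun v => β * J v) n (w ++ [i])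
    rw [hrat, exp_msg]
    simp only [sgn, if_true, Bool.false_eq_true, if_false, mul_one, mul_neg, neg_neg]
    set K := β * J w
    set Z := subZ c J β (n + 1) w true
    refine ⟨by positivity, ?_⟩
    have hc := cosh_pos (X + K)
    have e1 : exp (-K) + exp K * exp (-(2 * X)) = 2 * exp (-X) * cosh (X - K) := by
      rw [cosh_eq, ← exp_add]
      have : 2 * exp (-X) * ((exp (X - K) + exp (-(X - K))) / 2) =
        exp (-X) * exp (X - K) + exp (-X) * exp (-(X - K)) := by ring
      rw [this, ← exp_add, ← exp_add]
      ring_nf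
    have e2 : exp K + exp (-K) * exp (-(2 * X)) = 2 * exp (-X) * cosh (X + K) := by
      rw [cosh_eq, ← exp_add]
      have : 2 * exp (-X) * ((exp (X + K) + exp (-(X + K))) / 2) =
        exp (-X) * exp (X + K) + exp (-X) * exp (-(X + K)) := by ring
      rw [this, ← exp_add, ← exp_add]
      ring_nf
    have e3 : exp K * Z + exp (-K) * (exp (-(2 * X)) * Z) = 2 * exp (-X) * cosh (X + K) * Z := by
      rw [← e2]; ring
    have e4 : exp (-K) * Z + exp K * (exp (-(2 * X)) * Z) = 2 * exp (-X) * cosh (X - K) * Z := by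
      rw [← e1]; ring
    rw [e3, e4]
    field_simp

theorem plusProb_zero (c : Vtx → ℕ) (J : Vtx → ℝ) (β : ℝ) : plusProb c J β 0 = 1 := by
  rw [plusProb_eq]
  simp [subZ]

theorem plusProb_succ (c : Vtx → ℕ) (J : Vtx → ℝ) (β : ℝ) (n : ℕ) :
    plusProb c J β (n + 1) = (1 + exp (-(2 * ∑ i ∈ Finset.range (c []),
      edgeMsg c (fun v => β * J v) n ([] ++ [i]))))⁻¹ := by
  obtain ⟨hpos, hrat⟩ := subZ_succ_ratio (w := []) (edgeZ_ratio c J β n)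
  rw [plusProb_eq, hrat]
  field_simp

variable {c : Vtx → ℕ} {K : Vtx → ℝ}

theorem edgeMsg_nonneg (hK : ∀ v, IsVtx c v → v ≠ [] → 0 < K v) (n : ℕ) {w : Vtx}
    (hw : IsVtx c w) (hne : w ≠ []) : 0 ≤ edgeMsg c K n w := by
  induction n generalizing w with
  | zero => exact (hK w hw hne).le
  | succ n ih =>
    exact msg_nonneg (hK w hw hne) (Finset.sum_nonneg fun i hi =>
      ih (hw.child (Finset.mem_range.1 hi)) (by simp))

theorem edgeMsg_succ_le (hK : ∀ v, IsVtx c v → v ≠ [] → 0 < K v) (n : ℕ) {w : Vtx}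
    (hw : IsVtx c w) (hne : w ≠ []) : edgeMsg c K (n + 1) w ≤ edgeMsg c K n w := by
  induction n generalizing w with
  | zero => exact msg_le (hK w hw hne)
  | succ n ih =>
    exact msg_mono (hK w hw hne) (Finset.sum_le_sum fun i hi =>
      ih (hw.child (Finset.mem_range.1 hi)) (by simp))

/-- The infinite-volume limit of the messages. -/
def limMsg (c : Vtx → ℕ) (K : Vtx → ℝ) (w : Vtx) : ℝ := ⨅ n, edgeMsg c K n w

/-- The infinite-volume limit of the effective fields. -/
def limField (c : Vtx → ℕ) (K : Vtx → ℝ) (v : Vtx) : ℝ :=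
  ∑ i ∈ Finset.range (c v), limMsg c K (v ++ [i])

theorem tendsto_edgeMsg (hK : ∀ v, IsVtx c v → v ≠ [] → 0 < K v) {w : Vtx}
    (hw : IsVtx c w) (hne : w ≠ []) :
    Tendsto (fun n => edgeMsg c K n w) atTop (𝓝 (limMsg c K w)) :=
  tendsto_atTop_ciInf (antitone_nat_of_succ_le fun n => edgeMsg_succ_le hK n hw hne)
    ⟨0, by rintro _ ⟨n, rfl⟩; exact edgeMsg_nonneg hK n hw hne⟩

theorem limMsg_nonneg (hK : ∀ v, IsVtx c v → v ≠ [] → 0 < K v) {w : Vtx}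
    (hw : IsVtx c w) (hne : w ≠ []) : 0 ≤ limMsg c K w :=
  le_ciInf fun n => edgeMsg_nonneg hK n hw hne

theorem tendsto_field (hK : ∀ v, IsVtx c v → v ≠ [] → 0 < K v) {v : Vtx} (hv : IsVtx c v) :
    Tendsto (fun n => ∑ i ∈ Finset.range (c v), edgeMsg c K n (v ++ [i])) atTop
      (𝓝 (limField c K v)) :=
  tendsto_finsetSum _ fun _ hi =>
    tendsto_edgeMsg hK (hv.child (Finset.mem_range.1 hi)) (by simp)

theorem limField_nonneg (hK : ∀ v, IsVtx c v → v ≠ [] → 0 < K v) {v : Vtx} (hv : IsVtx c v) :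
    0 ≤ limField c K v :=
  Finset.sum_nonneg fun _ hi => limMsg_nonneg hK (hv.child (Finset.mem_range.1 hi)) (by simp)

theorem limMsg_eq (hK : ∀ v, IsVtx c v → v ≠ [] → 0 < K v) {w : Vtx}
    (hw : IsVtx c w) (hne : w ≠ []) : limMsg c K w = msg (K w) (limField c K w) :=
  tendsto_nhds_unique ((tendsto_add_atTop_iff_nat 1).2 (tendsto_edgeMsg hK hw hne))
    (((continuous_msg (K w)).tendsto _).comp (tendsto_field hK hw))

theorem antitone_plusProb {J : Vtx → ℝ} {β : ℝ} (hK : ∀ v, IsVtx c v → v ≠ [] → 0 < β * J v) :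
    Antitone (fun N : ℕ => plusProb c J β N) := by
  refine antitone_nat_of_succ_le fun n => ?_
  cases n with
  | zero =>
    rw [plusProb_zero, plusProb_succ]
    exact inv_le_one_of_one_le₀ (by linarith [exp_pos (-(2 * ∑ i ∈ Finset.range (c []),
      edgeMsg c (fun v => β * J v) 0 ([] ++ [i])))])
  | succ n =>
    rw [plusProb_succ, plusProb_succ]
    gcongr with i hi
    exact edgeMsg_succ_le hK n (IsVtx.root.child (Finset.mem_range.1 hi)) (by simp)

theorem tendsto_plusProb_half_iff {J : Vtx → ℝ} {β : ℝ}
    (hK : ∀ v, IsVtx c v → v ≠ [] → 0 < β * J v) :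
    Tendsto (fun N : ℕ => plusProb c J β N) atTop (𝓝 (1 / 2)) ↔
      limField c (fun v => β * J v) [] = 0 := by
  set X := limField c (fun v => β * J v) []
  have ht : Tendsto (fun N : ℕ => plusProb c J β N) atTop (𝓝 (1 + exp (-(2 * X)))⁻¹) := by
    rw [← tendsto_add_atTop_iff_nat 1]
    simp only [plusProb_succ]
    exact (((tendsto_field hK IsVtx.root).const_mul 2).neg.rexp.const_add 1).inv₀ (by positivity)
  constructor
  · intro h
    have h1 := tendsto_nhds_unique h ht
    rw [one_div, inv_inj] at h1
    have h2 : exp (-(2 * X)) = 1 := by linarith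
    rw [exp_eq_one_iff] at h2
    linarith
  · intro h
    convert ht using 2
    rw [h]
    norm_num

end Messages

section Capacity

variable {c : Vtx → ℕ} {K : Vtx → ℝ}

theorem IsVtx.take {v : Vtx} (hv : IsVtx c v) (k : ℕ) : IsVtx c (v.take k) := by
  induction hv with
  | root => simpa using IsVtx.root
  | @child v i hv hi ih =>
    rcases le_or_gt k v.length with hk | hk
    · rwa [List.take_append_of_le_length hk]
    · rw [List.take_of_length_le (by simpa using hk)]
      exact hv.child hi

theorem prod_take_concat {M : Type*} [CommMonoid M] (f : Vtx → M) (v : Vtx) (i : ℕ) :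
    ∏ k ∈ Finset.range (v ++ [i]).length, f ((v ++ [i]).take (k + 1)) =
      (∏ k ∈ Finset.range v.length, f (v.take (k + 1))) * f (v ++ [i]) := by
  rw [List.length_append, List.length_singleton, Finset.prod_range_succ]
  congr 1
  · refine Finset.prod_congr rfl fun k hk => ?_
    rw [List.take_append_of_le_length (Finset.mem_range.1 hk)]
  · rw [List.take_of_length_le (by simp)]

theorem sum_take_concat {M : Type*} [AddCommMonoid M] (f : Vtx → M) (v : Vtx) (i : ℕ) :
    ∑ k ∈ Finset.range (v ++ [i]).length, f ((v ++ [i]).take (k + 1)) =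
      (∑ k ∈ Finset.range v.length, f (v.take (k + 1))) + f (v ++ [i]) :=
  prod_take_concat (M := Multiplicative M) f v i

/-- The real-valued resistance of the edge above `w`. -/
def res (K : Vtx → ℝ) (w : Vtx) : ℝ := (∏ k ∈ Finset.range w.length, tanh (K (w.take (k + 1))))⁻¹

theorem res_nil (K : Vtx → ℝ) : res K [] = 1 := by simp [res]

theorem res_concat (K : Vtx → ℝ) (v : Vtx) (i : ℕ) :
    res K (v ++ [i]) = res K v * (tanh (K (v ++ [i])))⁻¹ := by
  rw [res, prod_take_concat (fun w => tanh (K w)), mul_inv, res]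

theorem take_succ_ne_nil {v : Vtx} {k : ℕ} (hk : k < v.length) : v.take (k + 1) ≠ [] := by
  intro h
  simp only [List.take_eq_nil_iff] at h
  rcases h with h | h
  · omega
  · simp [h] at hk

theorem tanh_take_pos (hK : ∀ v, IsVtx c v → v ≠ [] → 0 < K v) {v : Vtx} (hv : IsVtx c v) {k : ℕ}
    (hk : k ∈ Finset.range v.length) : 0 < tanh (K (v.take (k + 1))) :=
  tanh_pos' (hK _ (IsVtx.take hv _) (take_succ_ne_nil (Finset.mem_range.1 hk)))

theorem res_pos (hK : ∀ v, IsVtx c v → v ≠ [] → 0 < K v) {v : Vtx} (hv : IsVtx c v) :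
    0 < res K v :=
  inv_pos.2 (Finset.prod_pos fun _ hk => tanh_take_pos hK hv hk)

/-- The extended resistance of the edge above `w`. -/
def eres (K : Vtx → ℝ) (w : Vtx) : ℝ≥0∞ :=
  (∏ k ∈ Finset.range w.length, ENNReal.ofReal (tanh (K (w.take (k + 1)))))⁻¹

theorem eres_eq (hK : ∀ v, IsVtx c v → v ≠ [] → 0 < K v) {v : Vtx} (hv : IsVtx c v) :
    eres K v = ENNReal.ofReal (res K v) := by
  rw [eres, res, ← ENNReal.ofReal_prod_of_nonneg fun k hk => (tanh_take_pos hK hv hk).le,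
    ENNReal.ofReal_inv_of_pos (Finset.prod_pos fun _ hk => tanh_take_pos hK hv hk)]

theorem take_map_range (y : ℕ → ℕ) {k n : ℕ} (hk : k < n) :
    ((List.range n).map y).take (k + 1) = (List.range (k + 1)).map y := by
  rw [← List.map_take, List.take_range, min_eq_left hk]

theorem IsRay.isVtx {y : ℕ → ℕ} (hy : IsRay c y) (n : ℕ) : IsVtx c ((List.range n).map y) := by
  induction n with
  | zero => exact IsVtx.root
  | succ n ih =>
    rw [List.range_succ, List.map_append]
    exact ih.child (hy n)

theorem exists_ray (hleafless : ∀ v, IsVtx c v → 1 ≤ c v) {v : Vtx} (hv : IsVtx c v) :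
    ∃ y, IsRay c y ∧ (List.range v.length).map y = v := by
  have hpre : ∀ n ≤ v.length, (List.range n).map (fun k => v.getD k 0) = v.take n := by
    intro n hn
    refine List.ext_getElem (by simpa using hn) fun k hk _ => ?_
    have : k < v.length := by simp at hk; omega
    simp [this]
  have hlt : ∀ k, k < v.length → v.getD k 0 < c (v.take k) := by
    clear hpre
    induction hv with
    | root => simp
    | @child v i hv hi ih =>
      intro k hk
      rcases lt_or_eq_of_le (Nat.lt_succ_iff.1 (by simpa using hk) : k ≤ v.length) with h | rfl
      · have := ih k h
        rw [List.take_append_of_le_length h.le]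
        rwa [List.getD_append _ _ _ _ h]
      · simpa using hi
  refine ⟨fun k => v.getD k 0, fun n => ?_, by rw [hpre _ le_rfl, List.take_length]⟩
  suffices h : IsVtx c ((List.range n).map fun k => v.getD k 0) ∧
      v.getD n 0 < c ((List.range n).map fun k => v.getD k 0) from h.2
  have step : ∀ n, IsVtx c ((List.range n).map fun k => v.getD k 0) →
      v.getD n 0 < c ((List.range n).map fun k => v.getD k 0) := fun n hn => by
    rcases lt_or_ge n v.length with h | h
    · rw [hpre n h.le]; exact hlt n h
    · have : v.getD n 0 = 0 := by simp [h]
      rw [this]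
      exact hleafless _ hn
  have hvtx : IsVtx c ((List.range n).map fun k => v.getD k 0) := by
    induction n with
    | zero => exact IsVtx.root
    | succ n ih =>
      rw [List.range_succ, List.map_append]
      exact ih.child (step n ih)
  exact ⟨hvtx, step n hvtx⟩

/-- The potential of the flow `m` along the path from the root to `v`. -/
def pathPot (K m : Vtx → ℝ) (v : Vtx) : ℝ :=
  ∑ k ∈ Finset.range v.length, (m (v.take (k + 1)) * res K (v.take (k + 1))) ^ 2

theorem pathPot_concat (K m : Vtx → ℝ) (v : Vtx) (i : ℕ) :
    pathPot K m (v ++ [i]) = pathPot K m v + (m (v ++ [i]) * res K (v ++ [i])) ^ 2 :=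
  sum_take_concat (fun w => (m w * res K w) ^ 2) v i

section Lower

/-- The flow along which the limiting messages split, with total mass `κ` times the field at the
root. -/
def msgFlow (c : Vtx → ℕ) (K : Vtx → ℝ) (κ : ℝ) (w : Vtx) : ℝ :=
  κ * limField c K [] * ∏ k ∈ Finset.range w.length,
    (fun u => limMsg c K u / limField c K u.dropLast) (w.take (k + 1))

theorem msgFlow_concat (κ : ℝ) (v : Vtx) (i : ℕ) :
    msgFlow c K κ (v ++ [i]) = msgFlow c K κ v * (limMsg c K (v ++ [i]) / limField c K v) := by
  unfold msgFlow
  rw [prod_take_concat (fun u => limMsg c K u / limField c K u.dropLast), List.dropLast_concat]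
  ring

theorem msgFlow_nonneg (hK : ∀ v, IsVtx c v → v ≠ [] → 0 < K v) {κ : ℝ} (hκ : 0 ≤ κ) {v : Vtx}
    (hv : IsVtx c v) : 0 ≤ msgFlow c K κ v := by
  induction hv with
  | root => simpa [msgFlow] using mul_nonneg hκ (limField_nonneg hK IsVtx.root)
  | child hv hi ih =>
    rw [msgFlow_concat]
    exact mul_nonneg ih (div_nonneg (limMsg_nonneg hK (hv.child hi) (by simp))
      (limField_nonneg hK hv))

theorem sum_msgFlow {κ : ℝ} {v : Vtx} (h : limField c K v = 0 → msgFlow c K κ v = 0) :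
    ∑ i ∈ Finset.range (c v), msgFlow c K κ (v ++ [i]) = msgFlow c K κ v := by
  simp only [msgFlow_concat]
  rw [← Finset.mul_sum, ← Finset.sum_div]
  change _ * (limField c K v / limField c K v) = _
  rcases eq_or_ne (limField c K v) 0 with h0 | h0
  · rw [h h0, zero_mul]
  · rw [div_self h0, mul_one]

theorem msgFlow_eq_zero (hK : ∀ v, IsVtx c v → v ≠ [] → 0 < K v) {κ : ℝ} {v : Vtx}
    (hv : IsVtx c v) (h0 : limField c K v = 0) : msgFlow c K κ v = 0 := by
  cases hv with
  | root => simp [msgFlow, h0]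
  | child hv hi =>
    rw [msgFlow_concat, limMsg_eq hK (hv.child hi) (by simp), h0, msg_zero, zero_div, mul_zero]

theorem pathPot_msgFlow_le (hK : ∀ v, IsVtx c v → v ≠ [] → 0 < K v) {κ : ℝ} (hκ : 0 < κ)
    (hκK : ∀ v, IsVtx c v → v ≠ [] → κ ^ 2 ≤ 2 / 5 * (1 - tanh (K v) ^ 2))
    {v : Vtx} (hv : IsVtx c v) :
    pathPot K (msgFlow c K κ) v +
      (msgFlow c K κ v * res K v / (κ * limField c K v)) ^ 2 ≤ 1 := by
  induction hv with
  | root =>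
    simp only [pathPot, List.length_nil, Finset.range_zero, Finset.sum_empty, msgFlow,
      Finset.prod_empty, res_nil, mul_one, zero_add]
    rcases eq_or_ne (κ * limField c K []) 0 with h | h
    · simp [h]
    · rw [div_self h, one_pow]
  | @child v i hv hi ih =>
    have hw : IsVtx c (v ++ [i]) := hv.child hi
    have hne : v ++ [i] ≠ [] := by simp
    rw [pathPot_concat, add_assoc]
    refine le_trans (add_le_add_right ?_ _) ih
    rw [msgFlow_concat, res_concat]
    have hθ := tanh_pos' (hK _ hw hne)
    have hX := limField_nonneg hK hw
    have hup := msg_sq_le (hK _ hw hne) hX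
    rw [← limMsg_eq hK hw hne] at hup
    have hκw := hκK _ hw hne
    set a := limMsg c K (v ++ [i])
    set X := limField c K (v ++ [i])
    set θ := tanh (K (v ++ [i]))
    set F := msgFlow c K κ v
    set r := res K v
    set Y := limField c K v
    have hup' : (a / θ) ^ 2 * (1 + κ ^ 2 * X ^ 2) ≤ X ^ 2 := by
      have h1 : a ^ 2 * (1 + κ ^ 2 * X ^ 2) ≤ θ ^ 2 * X ^ 2 := by
        refine le_trans ?_ hup
        gcongr
      rw [div_pow, div_mul_eq_mul_div, div_le_iff₀ (by positivity)]
      linarith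
    have e1 : F * (a / Y) * (r * θ⁻¹) = (F * r / Y) * (a / θ) := by
      simp only [div_eq_mul_inv]; ring
    have e2 : F * r / (κ * Y) = (F * r / Y) * κ⁻¹ := by
      simp only [div_eq_mul_inv, mul_inv]; ring
    have e4 : F * r / Y * (a / θ) / (κ * X) = F * r / Y * (a / θ / (κ * X)) := mul_div_assoc ..
    rw [e1, e2, e4, mul_pow, mul_pow, mul_pow _ κ⁻¹, ← mul_add]
    refine mul_le_mul_of_nonneg_left ?_ (sq_nonneg _)
    rcases hX.eq_or_lt with h0 | h0
    · rw [← h0] at hup' ⊢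
      simp only [mul_zero, div_zero]
      have : (a / θ) ^ 2 ≤ 0 := by simpa using hup'
      nlinarith [sq_nonneg κ⁻¹]
    · have e3 : (a / θ) ^ 2 + (a / θ / (κ * X)) ^ 2 =
          ((a / θ) ^ 2 * (1 + κ ^ 2 * X ^ 2)) / (κ ^ 2 * X ^ 2) := by
        field_simp
        ring
      rw [e3, div_le_iff₀ (by positivity)]
      refine hup'.trans (le_of_eq ?_)
      field_simp

theorem ofReal_le_capInf (hK : ∀ v, IsVtx c v → v ≠ [] → 0 < K v) {κ : ℝ} (hκ : 0 < κ)
    (hκK : ∀ v, IsVtx c v → v ≠ [] → κ ^ 2 ≤ 2 / 5 * (1 - tanh (K v) ^ 2)) :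
    ENNReal.ofReal (κ * limField c K []) ≤ capInf c (eres K) 3 := by
  have hsum : ∀ v, IsVtx c v → ENNReal.ofReal (msgFlow c K κ v) =
      ∑ i ∈ Finset.range (c v), ENNReal.ofReal (msgFlow c K κ (v ++ [i])) := fun v hv => by
    rw [← sum_msgFlow (msgFlow_eq_zero hK hv), ENNReal.ofReal_sum_of_nonneg]
    exact fun i hi => msgFlow_nonneg hK hκ.le (hv.child (Finset.mem_range.1 hi))
  refine le_sSup ⟨fun w => ENNReal.ofReal (msgFlow c K κ w), fun v hv _ _ => hsum v hv,
    fun y hy => ?_, ?_⟩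
  · refine ENNReal.tsum_le_of_sum_range_le fun n => ?_
    have hterm : ∀ k, (ENNReal.ofReal (msgFlow c K κ ((List.range (k + 1)).map y)) *
        eres K ((List.range (k + 1)).map y)) ^ (3 - 1 : ℝ) =
        ENNReal.ofReal ((msgFlow c K κ ((List.range (k + 1)).map y) *
          res K ((List.range (k + 1)).map y)) ^ 2) := fun k => by
      have hv := IsRay.isVtx hy (k + 1)
      have h1 := msgFlow_nonneg hK hκ.le hv
      have h2 := (res_pos hK hv).le
      rw [eres_eq hK hv, ← ENNReal.ofReal_mul h1, show (3 - 1 : ℝ) = 2 by norm_num,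
        ENNReal.rpow_two, ENNReal.ofReal_pow (by positivity)]
    simp only [hterm]
    rw [← ENNReal.ofReal_sum_of_nonneg fun k _ => sq_nonneg _, ENNReal.ofReal_le_one]
    have h := pathPot_msgFlow_le hK hκ hκK (IsRay.isVtx hy n)
    refine le_trans (le_of_eq ?_) (le_trans (le_add_of_nonneg_right (sq_nonneg _)) h)
    simp only [pathPot, List.length_map, List.length_range]
    exact Finset.sum_congr rfl fun k hk => by rw [take_map_range y (Finset.mem_range.1 hk)]
  · rw [flowMass]
    have := hsum [] IsVtx.root
    simpa [msgFlow] using this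

end Lower

section Upper

theorem sq_le_edgeMsg_sq (hK : ∀ v, IsVtx c v → v ≠ [] → 0 < K v) {m : Vtx → ℝ}
    (hflow : ∀ v, IsVtx c v → v ≠ [] → m v = ∑ i ∈ Finset.range (c v), m (v ++ [i]))
    (hpot : ∀ v, IsVtx c v → pathPot K m v ≤ 1) (n : ℕ) {v : Vtx} {i : ℕ} (hv : IsVtx c v)
    (hi : i < c v) (hm : ∀ v, IsVtx c v → v ≠ [] → 0 ≤ m v) :
    (res K v * m (v ++ [i])) ^ 2 ≤ edgeMsg c K n (v ++ [i]) ^ 2 * (2 - pathPot K m v) := by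
  induction n generalizing v i with
  | zero =>
    have hw : IsVtx c (v ++ [i]) := hv.child hi
    have hKw := hK _ hw (by simp)
    have hθ := tanh_pos' hKw
    have hpw := hpot _ hw
    rw [pathPot_concat] at hpw
    have hp0 : 0 ≤ pathPot K m v := Finset.sum_nonneg fun _ _ => sq_nonneg _
    have hp := hpot v hv
    have hres : res K v = res K (v ++ [i]) * tanh (K (v ++ [i])) := by
      rw [res_concat, mul_assoc, inv_mul_cancel₀ hθ.ne', mul_one]
    have h1 : tanh (K (v ++ [i])) ^ 2 ≤ K (v ++ [i]) ^ 2 :=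
      pow_le_pow_left₀ hθ.le (tanh_le_self' hKw.le) 2
    calc (res K v * m (v ++ [i])) ^ 2
        = tanh (K (v ++ [i])) ^ 2 * (m (v ++ [i]) * res K (v ++ [i])) ^ 2 := by rw [hres]; ring
      _ ≤ K (v ++ [i]) ^ 2 * (2 - pathPot K m v) := by
        gcongr
        linarith
  | succ n ih =>
    have hw : IsVtx c (v ++ [i]) := hv.child hi
    have hne : v ++ [i] ≠ [] := by simp
    have hKw := hK _ hw hne
    have hθ := tanh_pos' hKw
    have hpw := hpot _ hw
    have hconcat := pathPot_concat K m v i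
    have hres : res K v = res K (v ++ [i]) * tanh (K (v ++ [i])) := by
      rw [res_concat, mul_assoc, inv_mul_cancel₀ hθ.ne', mul_one]
    have hr := res_pos hK hw
    have hmw := hm _ hw hne
    have hfloww := hflow _ hw hne
    have hstep : ∀ j ∈ Finset.range (c (v ++ [i])), res K (v ++ [i]) * m (v ++ [i] ++ [j]) ≤
        edgeMsg c K n (v ++ [i] ++ [j]) * √(2 - pathPot K m (v ++ [i])) := fun j hj => by
      have hj := Finset.mem_range.1 hj
      refine le_of_sq_le_sq ?_ (mul_nonneg (edgeMsg_nonneg hK n (hw.child hj) (by simp))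
        (Real.sqrt_nonneg _))
      rw [mul_pow (edgeMsg _ _ _ _), Real.sq_sqrt (by linarith)]
      exact ih hw hj
    have hsum := Finset.sum_le_sum hstep
    rw [← Finset.mul_sum, ← Finset.sum_mul, ← hfloww] at hsum
    have hX : 0 ≤ ∑ j ∈ Finset.range (c (v ++ [i])), edgeMsg c K n (v ++ [i] ++ [j]) :=
      Finset.sum_nonneg fun j hj =>
        edgeMsg_nonneg hK n (hw.child (Finset.mem_range.1 hj)) (by simp)
    have hsq := pow_le_pow_left₀ (mul_nonneg hr.le hmw) hsum 2
    rw [mul_pow (∑ j ∈ Finset.range (c (v ++ [i])), edgeMsg c K n (v ++ [i] ++ [j])),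
      Real.sq_sqrt (by linarith)] at hsq
    have hlow := le_msg_sq hKw hX
    simp only [edgeMsg]
    set X := ∑ j ∈ Finset.range (c (v ++ [i])), edgeMsg c K n (v ++ [i] ++ [j])
    set a := msg (K (v ++ [i])) X
    set θ := tanh (K (v ++ [i]))
    set D := 2 - pathPot K m (v ++ [i]) with hD
    set M := res K (v ++ [i]) * m (v ++ [i])
    have hDpos : 0 < D := by linarith
    have e1 : res K v * m (v ++ [i]) = θ * M := by rw [hres]; ring
    have e2 : 2 - pathPot K m v = D + M ^ 2 := by rw [hD, hconcat]; ring
    rw [e1, e2]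
    refine le_of_mul_le_mul_right ?_ (show 0 < 1 + X ^ 2 by positivity)
    have h1 := mul_le_mul_of_nonneg_right hlow (show 0 ≤ D + M ^ 2 by positivity)
    have h2 := mul_le_mul_of_nonneg_left hsq (sq_nonneg θ)
    linarith

theorem sum_le_sqrt_two_mul (hK : ∀ v, IsVtx c v → v ≠ [] → 0 < K v) {m : Vtx → ℝ}
    (hflow : ∀ v, IsVtx c v → v ≠ [] → m v = ∑ i ∈ Finset.range (c v), m (v ++ [i]))
    (hpot : ∀ v, IsVtx c v → pathPot K m v ≤ 1)
    (hm : ∀ v, IsVtx c v → v ≠ [] → 0 ≤ m v) :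
    ∑ i ∈ Finset.range (c []), m ([] ++ [i]) ≤ limField c K [] * √2 := by
  refine ge_of_tendsto' ((tendsto_field hK IsVtx.root).mul_const √2) fun n => ?_
  rw [Finset.sum_mul]
  refine Finset.sum_le_sum fun i hi => ?_
  have hi := Finset.mem_range.1 hi
  have h := sq_le_edgeMsg_sq hK hflow hpot n IsVtx.root hi hm
  refine le_of_sq_le_sq ?_ (mul_nonneg (edgeMsg_nonneg hK n (IsVtx.root.child hi) (by simp))
    (Real.sqrt_nonneg _))
  rw [mul_pow, Real.sq_sqrt zero_le_two]
  simpa [res_nil, pathPot] using h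

theorem leafPot_le_one (hleafless : ∀ v, IsVtx c v → 1 ≤ c v) {μ R : Vtx → ℝ≥0∞} {s : ℝ}
    (hμ : ∀ y : ℕ → ℕ, IsRay c y → rayPot μ R s y ≤ 1) {v : Vtx} (hv : IsVtx c v) :
    leafPot μ R s v ≤ 1 := by
  obtain ⟨y, hy, hyv⟩ := exists_ray hleafless hv
  refine le_trans ?_ (hμ y hy)
  refine le_trans (le_of_eq ?_) (ENNReal.sum_le_tsum (Finset.range v.length))
  refine Finset.sum_congr rfl fun k hk => ?_
  rw [← take_map_range y (Finset.mem_range.1 hk), hyv]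

theorem flowMass_eq_zero (hleafless : ∀ v, IsVtx c v → 1 ≤ c v)
    (hK : ∀ v, IsVtx c v → v ≠ [] → 0 < K v) (h0 : limField c K [] = 0) {μ : Vtx → ℝ≥0∞}
    (hflow : IsFlow c μ) (hμ : ∀ y : ℕ → ℕ, IsRay c y → rayPot μ (eres K) (3 - 1) y ≤ 1) :
    flowMass c μ = 0 := by
  have hleaf : ∀ v, IsVtx c v → leafPot μ (eres K) (3 - 1) v ≤ 1 := fun v hv =>
    leafPot_le_one hleafless hμ hv
  rw [show (3 - 1 : ℝ) = 2 by norm_num] at hleaf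
  have hfin : ∀ v, IsVtx c v → v ≠ [] → μ v ≠ ⊤ := by
    intro v hv hne htop
    cases hv with
    | root => exact hne rfl
    | @child v i hv hi =>
      have hw := hv.child hi
      have h := hleaf _ hw
      rw [leafPot, sum_take_concat (fun w => (μ w * eres K w) ^ (2 : ℝ)), htop, eres_eq hK hw,
        ENNReal.top_mul (by simpa using res_pos hK hw)] at h
      simp at h
  have hpot : ∀ v, IsVtx c v → pathPot K (fun w => (μ w).toReal) v ≤ 1 := by
    intro v hv
    have h := hleaf v hv
    have e : leafPot μ (eres K) 2 v = ENNReal.ofReal (pathPot K (fun w => (μ w).toReal) v) := by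
      rw [leafPot, pathPot, ENNReal.ofReal_sum_of_nonneg fun _ _ => sq_nonneg _]
      refine Finset.sum_congr rfl fun k hk => ?_
      have hk' := IsVtx.take hv (k + 1)
      have hr := (res_pos hK hk').le
      rw [ENNReal.ofReal_pow (by positivity), ENNReal.ofReal_mul (by positivity),
        ENNReal.ofReal_toReal (hfin _ hk' (take_succ_ne_nil (Finset.mem_range.1 hk))),
        ENNReal.rpow_two, eres_eq hK hk']
    rwa [e, ENNReal.ofReal_le_one] at h
  have hchild : ∀ v, IsVtx c v → ∀ i ∈ Finset.range (c v), μ (v ++ [i]) ≠ ⊤ := fun v hv i hi =>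
    hfin _ (hv.child (Finset.mem_range.1 hi)) (by simp)
  have hsum := sum_le_sqrt_two_mul hK (m := fun w => (μ w).toReal)
    (fun v hv hne => by
      rw [hflow v hv hne (Nat.one_le_iff_ne_zero.1 (hleafless v hv)),
        ENNReal.toReal_sum (hchild v hv)])
    hpot (fun _ _ _ => ENNReal.toReal_nonneg)
  rw [h0, zero_mul, ← ENNReal.toReal_sum (hchild [] IsVtx.root)] at hsum
  have h1 : (flowMass c μ).toReal = 0 := le_antisymm hsum ENNReal.toReal_nonneg
  rcases (ENNReal.toReal_eq_zero_iff _).1 h1 with h | h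
  · exact h
  · exact absurd h (ENNReal.sum_ne_top.2 (hchild [] IsVtx.root))

end Upper

end Capacity

end IsingTree

theorem stmt0 (c : Vtx → ℕ) (J : Vtx → ℝ) (β Jmin Jmax : ℝ)
    (hβ : 0 < β) (hJmin : 0 < Jmin)
    (hJ : ∀ v, IsVtx c v → v ≠ [] → Jmin ≤ J v ∧ J v ≤ Jmax)
    (hleafless : ∀ v, IsVtx c v → 1 ≤ c v) :
    Antitone (fun N : ℕ => plusProb c J β N) ∧
      (Filter.Tendsto (fun N : ℕ => plusProb c J β N) Filter.atTop (nhds (1 / 2)) ↔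
        capInf c
          (fun v => (∏ k ∈ Finset.range v.length,
            ENNReal.ofReal (Real.tanh (β * J (v.take (k + 1)))))⁻¹) 3 = 0) := by
  have hJmax : Jmin ≤ Jmax := by
    have h := hJ ([] ++ [0]) (IsVtx.root.child (hleafless [] IsVtx.root)) (by simp)
    exact h.1.trans h.2
  have hK : ∀ v, IsVtx c v → v ≠ [] → 0 < β * J v := fun v hv hne =>
    mul_pos hβ (hJmin.trans_le (hJ v hv hne).1)
  refine ⟨IsingTree.antitone_plusProb hK, (IsingTree.tendsto_plusProb_half_iff hK).trans ?_⟩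
  change _ ↔ capInf c (IsingTree.eres fun v => β * J v) 3 = 0
  constructor
  · intro h0
    refine le_antisymm (sSup_le ?_) bot_le
    rintro _ ⟨μ, hflow, hμ, rfl⟩
    exact (IsingTree.flowMass_eq_zero hleafless hK h0 hflow hμ).le
  · intro hcap
    set T := Real.tanh (β * Jmax)
    have hT0 : 0 < T := IsingTree.tanh_pos' (mul_pos hβ (hJmin.trans_le hJmax))
    have hT1 : T < 1 := Real.tanh_lt_one _
    have hpos : 0 < 2 / 5 * (1 - T ^ 2) := by nlinarith
    have hle := IsingTree.ofReal_le_capInf (κ := √(2 / 5 * (1 - T ^ 2))) hK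
      (Real.sqrt_pos.2 hpos) fun v hv hne => by
        rw [Real.sq_sqrt hpos.le]
        have h1 := IsingTree.tanh_pos' (hK v hv hne)
        have h2 : Real.tanh (β * J v) ≤ T := IsingTree.tanh_strictMono.monotone
          (mul_le_mul_of_nonneg_left (hJ v hv hne).2 hβ.le)
        have h3 := pow_le_pow_left₀ h1.le h2 2
        linarith
    rw [hcap, nonpos_iff_eq_zero, ENNReal.ofReal_eq_zero] at hle
    have hX := IsingTree.limField_nonneg hK IsVtx.root
    have := Real.sqrt_pos.2 hpos
    nlinarith
end
end

section
/- Let T be an infinite, locally finite rooted tree with root o and no leaves except possibly o, with interaction strengths J_v satisfying 0 < J_min ≤ J_v ≤ J_max and inverse temperature β > 0; set θ_v = tanh(β J_v). Assign to the edge from the parent of v to v the resistance R_v = Π_{o < y ≤ v} θ_y^{-2}. Then, under the free-boundary Ising measures P^(N), the boundary log-likelihood ratio X_o^(N) at the root converges in probability to 0 as N → ∞ (equivalently, the free-boundary Gibbs measure is extremal) if and only if cap_2(T) = 0. -/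
open scoped ENNReal Classical

noncomputable section

/-- `X_o^(N)`: the log-likelihood ratio of plus to minus at the root, given the boundary
configuration induced by `σ` on level `N` (a function of the boundary of `σ` only). -/
def XoOf (c : Vtx → ℕ) (J : Vtx → ℝ) (β : ℝ) (N : ℕ) (σ : Conf c N) : ℝ :=
  Real.log
    ((∑ τ : Conf c N, if (∀ x : {v // v ∈ verts c N}, x.1 ∈ lev c N → τ x = σ x)
        ∧ spin c N τ [] = 1 then wt c J β N τ else 0) /
     (∑ τ : Conf c N, if (∀ x : {v // v ∈ verts c N}, x.1 ∈ lev c N → τ x = σ x)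
        ∧ spin c N τ [] = -1 then wt c J β N τ else 0))

/-- The comparison between one edge of the percolation recursion and a resistor in series. -/
lemma exp_neg_le_of_series {p κ x : ℝ} (hp : 0 ≤ p) (hκ : 0 < κ)
    (hκp : 2 * κ ≤ 1 - p) (hx : 0 ≤ x) :
    Real.exp (-(p * (x / (1 + κ * x)))) ≤ 1 - p + p * Real.exp (-x) := by
  have hpos : ∀ y : ℝ, 0 < 1 - p + p * Real.exp (-y) := fun y => by
    have := mul_nonneg hp (Real.exp_pos (-y)).le
    linarith
  have hderiv : ∀ y : ℝ, 0 ≤ y → HasDerivAt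
      (fun y => p * (y / (1 + κ * y)) + Real.log (1 - p + p * Real.exp (-y)))
      (p * ((1 * (1 + κ * y) - y * (κ * 1)) / (1 + κ * y) ^ 2) +
        (p * (Real.exp (-y) * (-1))) / (1 - p + p * Real.exp (-y))) y := by
    intro y hy
    have h1 : (1 + κ * y) ≠ 0 := by positivity
    refine HasDerivAt.add (HasDerivAt.const_mul p (HasDerivAt.div (hasDerivAt_id y)
      (((hasDerivAt_id y).const_mul κ).const_add 1) h1)) (HasDerivAt.log ?_ (hpos y).ne')
    exact (((hasDerivAt_id y).neg.exp).const_mul p).const_add (1 - p)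
  have hmono : MonotoneOn
      (fun y => p * (y / (1 + κ * y)) + Real.log (1 - p + p * Real.exp (-y))) (Set.Ici 0) := by
    refine monotoneOn_of_deriv_nonneg (convex_Ici 0)
      (fun y hy => (hderiv y hy).continuousAt.continuousWithinAt)
      (fun y hy => (hderiv y (interior_subset hy)).differentiableAt.differentiableWithinAt) ?_
    intro y hy
    have hy0 : 0 ≤ y := interior_subset hy
    rw [(hderiv y hy0).deriv]
    have h1 : 0 < 1 + κ * y := by positivity
    have hq : 1 + y + y ^ 2 / 2 ≤ Real.exp y := Real.quadratic_le_exp_of_nonneg hy0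
    have hE : Real.exp (-y) * Real.exp y = 1 := by rw [← Real.exp_add]; simp
    have hkey : (1 + κ * y) ^ 2 ≤ (1 - p) * Real.exp y + p := by
      have hκ2 : κ ^ 2 ≤ (1 - p) / 2 := by nlinarith
      have h2 : (1 - p) * (1 + y + y ^ 2 / 2) ≤ (1 - p) * Real.exp y :=
        mul_le_mul_of_nonneg_left hq (by linarith)
      nlinarith [mul_le_mul_of_nonneg_right hκp hy0,
        mul_le_mul_of_nonneg_right hκ2 (sq_nonneg y)]
    have hmain : Real.exp (-y) * (1 + κ * y) ^ 2 ≤ 1 - p + p * Real.exp (-y) := by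
      calc Real.exp (-y) * (1 + κ * y) ^ 2
          ≤ Real.exp (-y) * ((1 - p) * Real.exp y + p) :=
            mul_le_mul_of_nonneg_left hkey (Real.exp_pos _).le
        _ = (1 - p) * (Real.exp (-y) * Real.exp y) + p * Real.exp (-y) := by ring
        _ = _ := by rw [hE]; ring
    have hfrac : Real.exp (-y) / (1 - p + p * Real.exp (-y)) ≤ 1 / (1 + κ * y) ^ 2 := by
      rw [div_le_div_iff₀ (hpos y) (by positivity)]
      linarith
    have := mul_le_mul_of_nonneg_left hfrac hp
    have e : p * ((1 * (1 + κ * y) - y * (κ * 1)) / (1 + κ * y) ^ 2) +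
        (p * (Real.exp (-y) * (-1))) / (1 - p + p * Real.exp (-y)) =
        p * (1 / (1 + κ * y) ^ 2) - p * (Real.exp (-y) / (1 - p + p * Real.exp (-y))) := by
      ring
    rw [e]
    linarith
  have h0 := hmono (Set.mem_Ici.2 le_rfl) (Set.mem_Ici.2 hx) hx
  simp only [zero_div, mul_zero, neg_zero, Real.exp_zero, mul_one, sub_add_cancel, Real.log_one,
    add_zero] at h0
  rw [← Real.le_log_iff_exp_le (hpos x)]
  linarith

lemma exp_neg_div_le_one_sub {p κ : ℝ} (hp : 0 ≤ p) (hκ : 0 < κ)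
    (hκp : 2 * κ ≤ 1 - p) : Real.exp (-(p * (1 / κ))) ≤ 1 - p := by
  have h1 : 0 < 1 - p := by linarith
  rw [← Real.le_log_iff_exp_le h1]
  have h2 := Real.one_sub_inv_le_log_of_pos h1
  have h3 : (1 - p)⁻¹ - 1 = p * (1 / (1 - p)) := by field_simp; ring
  have h4 : p * (1 / (1 - p)) ≤ p * (1 / κ) :=
    mul_le_mul_of_nonneg_left (one_div_le_one_div_of_le hκ (by linarith)) hp
  linarith

/-- `S / (1 + S)`, where `S` is the effective conductance from `v` to its `n`-th generation of
descendants, measured in units in which the edge to `v` has resistance one. -/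
def levelProb (c : Vtx → ℕ) (θ : Vtx → ℝ) : ℕ → Vtx → ℝ
  | 0, _ => 1
  | n + 1, v =>
    (∑ i ∈ Finset.range (c v), θ (v ++ [i]) ^ 2 * levelProb c θ n (v ++ [i])) /
      (1 + ∑ i ∈ Finset.range (c v), θ (v ++ [i]) ^ 2 * levelProb c θ n (v ++ [i]))

/-- The effective conductance from `v` to its descendants `n + 1` generations below. -/
def levelCond (c : Vtx → ℕ) (θ : Vtx → ℝ) (n : ℕ) (v : Vtx) : ℝ :=
  ∑ i ∈ Finset.range (c v), θ (v ++ [i]) ^ 2 * levelProb c θ n (v ++ [i])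

lemma levelProb_succ (c : Vtx → ℕ) (θ : Vtx → ℝ) (n : ℕ) (v : Vtx) :
    levelProb c θ (n + 1) v = levelCond c θ n v / (1 + levelCond c θ n v) := rfl

lemma levelProb_nonneg (c : Vtx → ℕ) (θ : Vtx → ℝ) (n : ℕ) (v : Vtx) :
    0 ≤ levelProb c θ n v := by
  induction n generalizing v with
  | zero => simp [levelProb]
  | succ n ih =>
    have : 0 ≤ levelCond c θ n v := Finset.sum_nonneg fun i _ => mul_nonneg (sq_nonneg _) (ih _)
    rw [levelProb_succ]
    positivity

lemma levelCond_nonneg (c : Vtx → ℕ) (θ : Vtx → ℝ) (n : ℕ) (v : Vtx) :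
    0 ≤ levelCond c θ n v :=
  Finset.sum_nonneg fun _ _ => mul_nonneg (sq_nonneg _) (levelProb_nonneg c θ n _)

lemma div_one_add_mono {a b : ℝ} (ha : 0 ≤ a) (hab : a ≤ b) : a / (1 + a) ≤ b / (1 + b) := by
  rw [div_le_div_iff₀ (by linarith) (by linarith)]
  nlinarith

lemma levelProb_succ_le (c : Vtx → ℕ) (θ : Vtx → ℝ) (n : ℕ) (v : Vtx) :
    levelProb c θ (n + 1) v ≤ levelProb c θ n v := by
  induction n generalizing v with
  | zero =>
    have := levelCond_nonneg c θ 0 v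
    rw [levelProb_succ, levelProb, div_le_one (by linarith)]
    linarith
  | succ n ih =>
    rw [levelProb_succ, levelProb_succ c θ n]
    exact div_one_add_mono (levelCond_nonneg _ _ _ _)
      (Finset.sum_le_sum fun i _ => mul_le_mul_of_nonneg_left (ih _) (sq_nonneg _))

lemma levelProb_antitone (c : Vtx → ℕ) (θ : Vtx → ℝ) (v : Vtx) :
    Antitone fun n => levelProb c θ n v :=
  antitone_nat_of_succ_le fun n => levelProb_succ_le c θ n v

/-- The limit of `levelProb` as the depth tends to infinity. -/
def limProb (c : Vtx → ℕ) (θ : Vtx → ℝ) (v : Vtx) : ℝ := ⨅ n, levelProb c θ n v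

/-- The effective conductance from `v` to infinity. -/
def limCond (c : Vtx → ℕ) (θ : Vtx → ℝ) (v : Vtx) : ℝ :=
  ∑ i ∈ Finset.range (c v), θ (v ++ [i]) ^ 2 * limProb c θ (v ++ [i])

lemma tendsto_levelProb (c : Vtx → ℕ) (θ : Vtx → ℝ) (v : Vtx) :
    Filter.Tendsto (fun n => levelProb c θ n v) Filter.atTop (nhds (limProb c θ v)) :=
  tendsto_atTop_ciInf (levelProb_antitone c θ v)
    ⟨0, by rintro _ ⟨n, rfl⟩; exact levelProb_nonneg c θ n v⟩

lemma tendsto_levelCond (c : Vtx → ℕ) (θ : Vtx → ℝ) (v : Vtx) :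
    Filter.Tendsto (fun n => levelCond c θ n v) Filter.atTop (nhds (limCond c θ v)) :=
  tendsto_finsetSum _ fun _ _ => (tendsto_levelProb c θ _).const_mul _

lemma limProb_nonneg (c : Vtx → ℕ) (θ : Vtx → ℝ) (v : Vtx) : 0 ≤ limProb c θ v :=
  ge_of_tendsto' (tendsto_levelProb c θ v) fun n => levelProb_nonneg c θ n v

lemma limProb_le_one (c : Vtx → ℕ) (θ : Vtx → ℝ) (v : Vtx) : limProb c θ v ≤ 1 :=
  le_of_tendsto' (tendsto_levelProb c θ v) fun n =>
    (levelProb_antitone c θ v (Nat.zero_le n)).trans_eq rfl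

lemma limCond_nonneg (c : Vtx → ℕ) (θ : Vtx → ℝ) (v : Vtx) : 0 ≤ limCond c θ v :=
  ge_of_tendsto' (tendsto_levelCond c θ v) fun n => levelCond_nonneg c θ n v

lemma limProb_eq (c : Vtx → ℕ) (θ : Vtx → ℝ) (v : Vtx) :
    limProb c θ v = limCond c θ v / (1 + limCond c θ v) := by
  have h0 := limCond_nonneg c θ v
  have h1 := (tendsto_levelCond c θ v).div ((tendsto_levelCond c θ v).const_add 1)
    (ne_of_gt (by linarith))
  exact tendsto_nhds_unique ((tendsto_levelProb c θ v).comp (Filter.tendsto_add_atTop_nat 1)) h1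

@[to_additive]
lemma prod_take_concat {M : Type*} [CommMonoid M] (F : Vtx → M) (v : Vtx) (i : ℕ) :
    ∏ k ∈ Finset.range (v ++ [i]).length, F ((v ++ [i]).take (k + 1)) =
      (∏ k ∈ Finset.range v.length, F (v.take (k + 1))) * F (v ++ [i]) := by
  have hl : (v ++ [i]).length = v.length + 1 := by simp
  rw [hl, Finset.prod_range_succ]
  congr 1
  · refine Finset.prod_congr rfl fun k hk => ?_
    rw [List.take_append_of_le_length (Finset.mem_range.1 hk)]
  · rw [List.take_of_length_le hl.le]

lemma IsVtx.exists_of_ne_nil {c : Vtx → ℕ} {v : Vtx} (h : IsVtx c v) (hv : v ≠ []) :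
    ∃ w i, IsVtx c w ∧ i < c w ∧ v = w ++ [i] := by
  cases h with
  | root => exact absurd rfl hv
  | child hw hi => exact ⟨_, _, hw, hi, rfl⟩

lemma IsVtx.of_concat {c : Vtx → ℕ} {v : Vtx} {i : ℕ} (h : IsVtx c (v ++ [i])) :
    IsVtx c v ∧ i < c v := by
  obtain ⟨w, j, hw, hj, e⟩ := h.exists_of_ne_nil (by simp)
  obtain ⟨rfl, hij⟩ := List.append_inj' e rfl
  obtain rfl : i = j := by simpa using hij
  exact ⟨hw, hj⟩

lemma IsVtx.take {c : Vtx → ℕ} {v : Vtx} (h : IsVtx c v) (n : ℕ) : IsVtx c (v.take n) := by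
  induction h with
  | root => simpa using IsVtx.root
  | @child v i hv hi ih =>
    rcases le_or_gt n v.length with hn | hn
    · rwa [List.take_append_of_le_length hn]
    · rw [List.take_of_length_le (by simpa using hn)]
      exact hv.child hi

lemma map_range_succ_eq (y : ℕ → ℕ) (n : ℕ) :
    (List.range (n + 1)).map y = (List.range n).map y ++ [y n] := by
  simp [List.range_succ]

lemma IsRay.isVtx {c : Vtx → ℕ} {y : ℕ → ℕ} (h : IsRay c y) (n : ℕ) :
    IsVtx c ((List.range n).map y) := by
  induction n with
  | zero => simpa using IsVtx.root
  | succ n ih =>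
    rw [map_range_succ_eq]
    exact ih.child (h n)

lemma exists_ray_through {c : Vtx → ℕ} (hc : ∀ v, IsVtx c v → 1 ≤ c v) {v : Vtx}
    (hv : IsVtx c v) : ∃ y, IsRay c y ∧ ∀ n ≤ v.length, (List.range n).map y = v.take n := by
  have hpre : ∀ n ≤ v.length, (List.range n).map (fun k => v.getD k 0) = v.take n := by
    intro n hn
    refine List.ext_getElem (by simp [hn]) fun k h1 h2 => ?_
    have hk : k < v.length := by simp at h2; omega
    simp [hk]
  refine ⟨fun k => v.getD k 0, ?_, hpre⟩
  have step : ∀ n, IsVtx c ((List.range n).map fun k => v.getD k 0) →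
      v.getD n 0 < c ((List.range n).map fun k => v.getD k 0) := by
    intro n hn
    rcases lt_or_ge n v.length with h | h
    · have h1 := hv.take (n + 1)
      rw [← hpre (n + 1) h, map_range_succ_eq] at h1
      exact h1.of_concat.2
    · rw [List.getD_eq_default _ _ h]
      exact hc _ hn
  have key : ∀ n, IsVtx c ((List.range n).map fun k => v.getD k 0) := by
    intro n
    induction n with
    | zero => simpa using IsVtx.root
    | succ n ih =>
      rw [map_range_succ_eq]
      exact ih.child (step n ih)
  exact fun n => step n (key n)

/-- The product of the squared edge parameters along the path from the root. -/
def pathSq (θ : Vtx → ℝ) (v : Vtx) : ℝ := ∏ k ∈ Finset.range v.length, θ (v.take (k + 1)) ^ 2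

/-- The edge resistances `∏ θ⁻²`. -/
def treeRes (θ : Vtx → ℝ) (v : Vtx) : ℝ≥0∞ :=
  (∏ k ∈ Finset.range v.length, (ENNReal.ofReal (θ (v.take (k + 1)))) ^ 2)⁻¹

lemma pathSq_nil (θ : Vtx → ℝ) : pathSq θ [] = 1 := by simp [pathSq]

lemma pathSq_concat (θ : Vtx → ℝ) (v : Vtx) (i : ℕ) :
    pathSq θ (v ++ [i]) = pathSq θ v * θ (v ++ [i]) ^ 2 :=
  prod_take_concat (fun w => θ w ^ 2) v i

lemma pathSq_pos {c : Vtx → ℕ} {θ : Vtx → ℝ} (hθ : ∀ v, IsVtx c v → v ≠ [] → 0 < θ v) {v : Vtx}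
    (hv : IsVtx c v) : 0 < pathSq θ v := by
  refine Finset.prod_pos fun k hk => pow_pos (hθ _ (hv.take _) ?_) 2
  intro h
  have := congrArg List.length h
  simp only [List.length_take, List.length_nil] at this
  have := Finset.mem_range.1 hk
  omega

lemma treeRes_eq {c : Vtx → ℕ} {θ : Vtx → ℝ} (hθ : ∀ v, IsVtx c v → v ≠ [] → 0 < θ v) {v : Vtx}
    (hv : IsVtx c v) : treeRes θ v = ENNReal.ofReal (pathSq θ v)⁻¹ := by
  rw [ENNReal.ofReal_inv_of_pos (pathSq_pos hθ hv), treeRes, pathSq,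
    ENNReal.ofReal_prod_of_nonneg fun _ _ => sq_nonneg _]
  congr 1
  refine Finset.prod_congr rfl fun k hk => ?_
  rw [ENNReal.ofReal_pow (hθ _ (hv.take _) ?_).le]
  intro h
  have := congrArg List.length h
  simp only [List.length_take, List.length_nil] at this
  have := Finset.mem_range.1 hk
  omega

/-- Voltages of the limiting current flow (one at the root, zero at infinity). -/
def voltage (c : Vtx → ℕ) (θ : Vtx → ℝ) (v : Vtx) : ℝ :=
  ∏ k ∈ Finset.range v.length, (1 - limProb c θ (v.take (k + 1)))

lemma voltage_nil (c : Vtx → ℕ) (θ : Vtx → ℝ) : voltage c θ [] = 1 := by simp [voltage]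

lemma voltage_concat (c : Vtx → ℕ) (θ : Vtx → ℝ) (v : Vtx) (i : ℕ) :
    voltage c θ (v ++ [i]) = voltage c θ v * (1 - limProb c θ (v ++ [i])) :=
  prod_take_concat (fun w => 1 - limProb c θ w) v i

lemma voltage_nonneg (c : Vtx → ℕ) (θ : Vtx → ℝ) (v : Vtx) : 0 ≤ voltage c θ v :=
  Finset.prod_nonneg fun _ _ => by linarith [limProb_le_one c θ (v.take (‹ℕ› + 1))]

/-- The limiting current flow. -/
def current (c : Vtx → ℕ) (θ : Vtx → ℝ) (v : Vtx) : ℝ :=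
  voltage c θ v.dropLast * limProb c θ v * pathSq θ v

lemma sum_current (c : Vtx → ℕ) (θ : Vtx → ℝ) (v : Vtx) :
    ∑ i ∈ Finset.range (c v), current c θ (v ++ [i]) =
      voltage c θ v * limCond c θ v * pathSq θ v := by
  simp only [current, List.dropLast_concat, pathSq_concat, limCond, Finset.mul_sum,
    Finset.sum_mul]
  exact Finset.sum_congr rfl fun _ _ => by ring

lemma pathSq_nonneg (θ : Vtx → ℝ) (v : Vtx) : 0 ≤ pathSq θ v :=
  Finset.prod_nonneg fun _ _ => sq_nonneg _

lemma current_nonneg (c : Vtx → ℕ) (θ : Vtx → ℝ) (v : Vtx) : 0 ≤ current c θ v :=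
  mul_nonneg (mul_nonneg (voltage_nonneg _ _ _) (limProb_nonneg _ _ _)) (pathSq_nonneg _ _)

lemma isFlow_current (c : Vtx → ℕ) (θ : Vtx → ℝ) :
    IsFlow c fun v => ENNReal.ofReal (current c θ v) := by
  intro v _ hne _
  obtain ⟨w, i, rfl⟩ : ∃ w i, v = w ++ [i] :=
    ⟨v.dropLast, v.getLast hne, (List.dropLast_append_getLast hne).symm⟩
  beta_reduce
  rw [← ENNReal.ofReal_sum_of_nonneg fun _ _ => current_nonneg _ _ _, sum_current, voltage_concat]
  have h0 := limCond_nonneg c θ (w ++ [i])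
  have h : limProb c θ (w ++ [i]) =
      (1 - limProb c θ (w ++ [i])) * limCond c θ (w ++ [i]) := by
    rw [limProb_eq]
    field_simp
    ring
  rw [mul_assoc (voltage c θ w), ← h, current, List.dropLast_concat]

lemma rayPot_current_le {c : Vtx → ℕ} {θ : Vtx → ℝ} (hθ : ∀ v, IsVtx c v → v ≠ [] → 0 < θ v)
    {y : ℕ → ℕ} (hy : IsRay c y) :
    rayPot (fun v => ENNReal.ofReal (current c θ v)) (treeRes θ) (2 - 1) y ≤ 1 := by
  refine ENNReal.tsum_le_of_sum_range_le fun n => ?_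
  have hterm : ∀ k, (ENNReal.ofReal (current c θ ((List.range (k + 1)).map y)) *
      treeRes θ ((List.range (k + 1)).map y)) ^ (2 - 1 : ℝ) =
      ENNReal.ofReal (voltage c θ ((List.range k).map y) -
        voltage c θ ((List.range (k + 1)).map y)) := by
    intro k
    have hv := hy.isVtx (k + 1)
    have hp := pathSq_pos hθ hv
    norm_num only
    rw [ENNReal.rpow_one, treeRes_eq hθ hv, ← ENNReal.ofReal_mul (current_nonneg _ _ _), current,
      mul_assoc, mul_inv_cancel₀ hp.ne', map_range_succ_eq, voltage_concat, List.dropLast_concat]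
    congr 1
    ring
  have hnonneg : ∀ k, 0 ≤ voltage c θ ((List.range k).map y) -
      voltage c θ ((List.range (k + 1)).map y) := by
    intro k
    rw [map_range_succ_eq, voltage_concat]
    have := mul_nonneg (voltage_nonneg c θ ((List.range k).map y))
      (limProb_nonneg c θ ((List.range k).map y ++ [y k]))
    linarith
  rw [Finset.sum_congr rfl fun k _ => hterm k,
    ← ENNReal.ofReal_sum_of_nonneg fun k _ => hnonneg k, Finset.sum_range_sub']
  simp only [List.range_zero, List.map_nil, voltage_nil]
  have := voltage_nonneg c θ ((List.range n).map y)
  exact ENNReal.ofReal_le_one.2 (by linarith)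

lemma flowMass_current (c : Vtx → ℕ) (θ : Vtx → ℝ) :
    flowMass c (fun v => ENNReal.ofReal (current c θ v)) = ENNReal.ofReal (limCond c θ []) := by
  have := sum_current c θ []
  rw [voltage_nil, pathSq_nil, one_mul, mul_one] at this
  rw [flowMass, ← this, ENNReal.ofReal_sum_of_nonneg fun _ _ => current_nonneg _ _ _]
  rfl

/-- A flow all of whose path potentials are at most one is bounded by the effective conductance. -/
lemma flow_le_levelCond {c : Vtx → ℕ} {θ : Vtx → ℝ}
    (hθ : ∀ v, IsVtx c v → v ≠ [] → 0 < θ v) {m : Vtx → ℝ}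
    (hflow : ∀ v, IsVtx c v → v ≠ [] → m v = ∑ i ∈ Finset.range (c v), m (v ++ [i]))
    (hpot : ∀ v, IsVtx c v →
      ∑ k ∈ Finset.range v.length, m (v.take (k + 1)) / pathSq θ (v.take (k + 1)) ≤ 1)
    (n : ℕ) {v : Vtx} (hv : IsVtx c v) :
    ∑ i ∈ Finset.range (c v), m (v ++ [i]) ≤
      (1 - ∑ k ∈ Finset.range v.length, m (v.take (k + 1)) / pathSq θ (v.take (k + 1))) *
        levelCond c θ n v * pathSq θ v := by
  induction n using Nat.strong_induction_on generalizing v with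
  | _ n ih =>
  have hchild : ∀ (i : ℕ), i < c v → ∀ u : ℝ,
      m (v ++ [i]) / pathSq θ (v ++ [i]) ≤ (1 - ∑ k ∈ Finset.range v.length,
        m (v.take (k + 1)) / pathSq θ (v.take (k + 1))) * u →
      m (v ++ [i]) ≤ (1 - ∑ k ∈ Finset.range v.length,
        m (v.take (k + 1)) / pathSq θ (v.take (k + 1))) * (θ (v ++ [i]) ^ 2 * u) * pathSq θ v := by
    intro i hi u h
    have hp := pathSq_pos hθ (hv.child hi)
    rw [div_le_iff₀ hp, pathSq_concat] at h
    linarith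
  have hsum := sum_take_concat fun w => m w / pathSq θ w
  rw [levelCond, Finset.mul_sum, Finset.sum_mul]
  refine Finset.sum_le_sum fun i hi => ?_
  have hi := Finset.mem_range.1 hi
  have hw := hv.child hi
  refine hchild i hi _ ?_
  have h1 := hpot _ hw
  rw [hsum] at h1
  cases n with
  | zero =>
    rw [levelProb]
    linarith
  | succ n =>
    have h2 := ih n (Nat.lt_succ_self n) hw
    have hp := pathSq_pos hθ hw
    have h0 := levelCond_nonneg c θ n (v ++ [i])
    rw [← hflow _ hw (by simp), hsum, ← div_le_iff₀ hp] at h2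
    rw [levelProb_succ, ← mul_div_assoc, le_div_iff₀ (by linarith)]
    linarith

lemma capInf_eq_zero_iff {c : Vtx → ℕ} {θ : Vtx → ℝ} (hθ : ∀ v, IsVtx c v → v ≠ [] → 0 < θ v)
    (hc : ∀ v, IsVtx c v → 1 ≤ c v) :
    capInf c (treeRes θ) 2 = 0 ↔ limCond c θ [] = 0 := by
  constructor
  · intro h
    have h1 : ENNReal.ofReal (limCond c θ []) ≤ capInf c (treeRes θ) 2 :=
      le_sSup ⟨_, isFlow_current c θ, fun y hy => rayPot_current_le hθ hy,
        (flowMass_current c θ).symm⟩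
    rw [h] at h1
    exact le_antisymm (ENNReal.ofReal_eq_zero.1 (le_zero_iff.1 h1)) (limCond_nonneg c θ [])
  · intro h
    refine le_zero_iff.1 (sSup_le ?_)
    rintro _ ⟨μ, hμ, hV, rfl⟩
    have hpotE : ∀ v, IsVtx c v →
        ∑ k ∈ Finset.range v.length, μ (v.take (k + 1)) * treeRes θ (v.take (k + 1)) ≤ 1 := by
      intro v hv
      obtain ⟨y, hy, hpre⟩ := exists_ray_through hc hv
      refine le_trans ?_ (hV y hy)
      refine le_trans (le_of_eq ?_) (ENNReal.sum_le_tsum (Finset.range v.length))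
      refine Finset.sum_congr rfl fun k hk => ?_
      rw [hpre _ (Finset.mem_range.1 hk)]
      norm_num
    have htake : ∀ v : Vtx, ∀ k ∈ Finset.range v.length, v.take (k + 1) ≠ [] := by
      intro v k hk h
      have := congrArg List.length h
      simp only [List.length_take, List.length_nil] at this
      have := Finset.mem_range.1 hk
      omega
    have hfin : ∀ v, IsVtx c v → v ≠ [] → μ v ≠ ⊤ := by
      intro v hv hne htop
      obtain ⟨w, i, hw, hi, rfl⟩ := hv.exists_of_ne_nil hne
      have h1 := hpotE _ hv
      rw [sum_take_concat fun w => μ w * treeRes θ w, htop, treeRes_eq hθ hv, ENNReal.top_mul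
        (by simpa using pathSq_pos hθ hv)] at h1
      simp at h1
    have hm := fun n => flow_le_levelCond hθ (m := fun v => (μ v).toReal)
      (fun v hv hne => by
        rw [hμ v hv hne (Nat.one_le_iff_ne_zero.1 (hc v hv)), ENNReal.toReal_sum]
        exact fun i hi => hfin _ (hv.child (Finset.mem_range.1 hi)) (by simp))
      (fun v hv => by
        have h1 := ENNReal.toReal_mono ENNReal.one_ne_top (hpotE v hv)
        rw [ENNReal.toReal_sum, ENNReal.toReal_one] at h1
        · refine le_trans (le_of_eq (Finset.sum_congr rfl fun k hk => ?_)) h1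
          rw [treeRes_eq hθ (hv.take _), ENNReal.toReal_mul, ENNReal.toReal_ofReal
            (inv_nonneg.2 (pathSq_nonneg _ _)), div_eq_mul_inv]
        · intro k hk
          rw [treeRes_eq hθ (hv.take _)]
          exact ENNReal.mul_ne_top (hfin _ (hv.take _) (htake v k hk)) ENNReal.ofReal_ne_top)
      n (v := []) IsVtx.root
    simp only [List.length_nil, Finset.range_zero, Finset.sum_empty, sub_zero, one_mul, pathSq_nil,
      mul_one] at hm
    have h2 := ge_of_tendsto' (tendsto_levelCond c θ []) hm
    rw [h] at h2
    have hterm : ∀ i ∈ Finset.range (c []), μ ([] ++ [i]) ≠ ⊤ := fun i hi =>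
      hfin _ (IsVtx.root.child (Finset.mem_range.1 hi)) (by simp)
    rw [← ENNReal.toReal_sum hterm] at h2
    have h3 := le_antisymm h2 ENNReal.toReal_nonneg
    rw [ENNReal.toReal_eq_zero_iff] at h3
    rcases h3 with h3 | h3
    · exact h3.le
    · exact absurd h3 (ENNReal.sum_ne_top.2 hterm)

/-- The spin `±1` encoded by a Boolean. -/
def sgn (s : Bool) : ℝ := if s then 1 else -1

section Channels

variable {α : Type*}

/-- The likelihoods of an observation made through a binary symmetric channel of bias `t`. -/
def noisy (t : ℝ) (ℓ : Bool → α → ℝ) (s : Bool) (a : α) : ℝ :=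
  (1 + t) / 2 * ℓ s a + (1 - t) / 2 * ℓ (!s) a

lemma noisy_nonneg {t : ℝ} {ℓ : Bool → α → ℝ} (ht : 0 < t) (ht1 : t < 1) (h : ∀ s a, 0 ≤ ℓ s a)
    (s : Bool) (a : α) : 0 ≤ noisy t ℓ s a :=
  add_nonneg (mul_nonneg (by linarith) (h _ _)) (mul_nonneg (by linarith) (h _ _))

lemma noisy_pos {t : ℝ} {ℓ : Bool → α → ℝ} (ht : 0 < t) (ht1 : t < 1) (h : ∀ s a, 0 ≤ ℓ s a)
    (s : Bool) (a : α) (hs : 0 < ℓ s a + ℓ (!s) a) : 0 < noisy t ℓ s a := by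
  have := mul_pos (sub_pos.2 ht1) hs
  have := mul_nonneg ht.le (h s a)
  rw [noisy]
  linarith

variable [Fintype α]

/-- The Hellinger affinity of the two laws `ℓ true` and `ℓ false`. -/
def affinity (ℓ : Bool → α → ℝ) : ℝ := ∑ a, √(ℓ true a * ℓ false a)

lemma affinity_nonneg (ℓ : Bool → α → ℝ) : 0 ≤ affinity ℓ :=
  Finset.sum_nonneg fun _ _ => Real.sqrt_nonneg _

lemma sum_noisy_mul (t : ℝ) (ℓ : Bool → α → ℝ) (s : Bool) (z : α → ℝ) :
    ∑ a, noisy t ℓ s a * z a =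
      (1 + t) / 2 * ∑ a, ℓ s a * z a + (1 - t) / 2 * ∑ a, ℓ (!s) a * z a := by
  simp only [noisy, Finset.mul_sum, ← Finset.sum_add_distrib]
  exact Finset.sum_congr rfl fun _ _ => by ring

lemma sum_noisy {t : ℝ} {ℓ : Bool → α → ℝ} (h : ∀ s, ∑ a, ℓ s a = 1) (s : Bool) :
    ∑ a, noisy t ℓ s a = 1 := by
  have := sum_noisy_mul t ℓ s fun _ => 1
  simp only [mul_one, h] at this
  rw [this]
  ring

lemma affinity_noisy {t : ℝ} {ℓ : Bool → α → ℝ} (ht : 0 < t) (ht1 : t < 1)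
    (h0 : ∀ s a, 0 ≤ ℓ s a) (h1 : ∀ s, ∑ a, ℓ s a = 1) :
    1 - t ^ 2 * (1 - affinity ℓ ^ 2) ≤ affinity (noisy t ℓ) ^ 2 := by
  set h := affinity ℓ with hh
  have ht2 : t ^ 2 < 1 := by nlinarith
  have hρ : 0 < 1 - t ^ 2 * (1 - h ^ 2) := by nlinarith [sq_nonneg (t * h)]
  set ρ := √(1 - t ^ 2 * (1 - h ^ 2)) with hρd
  have hρsq : ρ ^ 2 = 1 - t ^ 2 * (1 - h ^ 2) := Real.sq_sqrt hρ.le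
  have hρpos : 0 < ρ := Real.sqrt_pos.2 hρ
  have hpt : ∀ a, (1 - t ^ 2) * ((ℓ true a + ℓ false a) / 2) +
      t ^ 2 * h * √(ℓ true a * ℓ false a) ≤ √(noisy t ℓ true a * noisy t ℓ false a) * ρ := by
    intro a
    have hx := h0 true a
    have hy := h0 false a
    have hq := Real.sq_sqrt (mul_nonneg hx hy)
    set q := √(ℓ true a * ℓ false a)
    rw [hρd, ← Real.sqrt_mul (mul_nonneg (noisy_nonneg ht ht1 h0 _ _)
      (noisy_nonneg ht ht1 h0 _ _))]
    refine Real.le_sqrt_of_sq_le ?_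
    have e : noisy t ℓ true a * noisy t ℓ false a =
        (1 - t ^ 2) * ((ℓ true a + ℓ false a) / 2) ^ 2 + t ^ 2 * q ^ 2 := by
      rw [hq]
      simp only [noisy, Bool.not_true, Bool.not_false]
      ring
    rw [e]
    have hcs := mul_nonneg (mul_nonneg (sub_nonneg.2 ht2.le) (sq_nonneg t))
      (sq_nonneg ((ℓ true a + ℓ false a) / 2 * h - q))
    nlinarith
  have hsum := Finset.sum_le_sum fun a (_ : a ∈ Finset.univ) => hpt a
  rw [Finset.sum_add_distrib, ← Finset.mul_sum, ← Finset.mul_sum, ← Finset.sum_mul,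
    ← Finset.sum_div, Finset.sum_add_distrib, h1, h1] at hsum
  change _ + t ^ 2 * h * affinity ℓ ≤ affinity (noisy t ℓ) * ρ at hsum
  rw [← hh] at hsum
  have h2 : ρ * ρ ≤ affinity (noisy t ℓ) * ρ := by nlinarith
  rw [← hρsq]
  exact pow_le_pow_left₀ hρpos.le (le_of_mul_le_mul_right h2 hρpos) 2

end Channels

section Products

variable {ι : Type*} [Fintype ι] [DecidableEq ι] {β : ι → Type*} [∀ i, Fintype (β i)]

lemma sum_pi_prod (f : ∀ i, β i → ℝ) : ∑ b : ∀ i, β i, ∏ i, f i (b i) = ∏ i, ∑ a, f i a := by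
  rw [Finset.prod_univ_sum, Fintype.piFinset_univ]

lemma affinity_pi {ℓ : ∀ i, Bool → β i → ℝ} (h : ∀ i s a, 0 ≤ ℓ i s a) :
    affinity (fun s (b : ∀ i, β i) => ∏ i, ℓ i s (b i)) = ∏ i, affinity (ℓ i) := by
  simp only [affinity, ← sum_pi_prod, ← Finset.prod_mul_distrib]
  exact Finset.sum_congr rfl fun b _ =>
    Real.sqrt_prod _ fun i _ => mul_nonneg (h _ _ _) (h _ _ _)

lemma sum_pi_prod_mul {ℓ : ∀ i, β i → ℝ} (h : ∀ i, ∑ a, ℓ i a = 1) (z : ∀ i, β i → ℝ) (j : ι) :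
    ∑ b : ∀ i, β i, (∏ i, ℓ i (b i)) * z j (b j) = ∑ a, ℓ j a * z j a := by
  have e := sum_pi_prod fun i a => ℓ i a * if i = j then z i a else 1
  simp only [Finset.prod_mul_distrib, Finset.prod_ite_eq', Finset.mem_univ, if_true] at e
  rw [e, Finset.prod_eq_single j]
  · simp
  · intro i _ hi
    simp [hi, h]
  · simp

lemma sum_pi_prod_mul_mul {ℓ : ∀ i, β i → ℝ} (h : ∀ i, ∑ a, ℓ i a = 1) (z : ∀ i, β i → ℝ)
    {j k : ι} (hjk : j ≠ k) :
    ∑ b : ∀ i, β i, (∏ i, ℓ i (b i)) * (z j (b j) * z k (b k)) =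
      (∑ a, ℓ j a * z j a) * ∑ a, ℓ k a * z k a := by
  have e := sum_pi_prod fun i a => ℓ i a * ((if i = j then z i a else 1) *
    if i = k then z i a else 1)
  simp only [Finset.prod_mul_distrib, Finset.prod_ite_eq', Finset.mem_univ, if_true] at e
  have e2 : ∀ i, ∑ a, ℓ i a * ((if i = j then z i a else 1) * if i = k then z i a else 1) =
      (if i = j then ∑ a, ℓ i a * z i a else 1) * if i = k then ∑ a, ℓ i a * z i a else 1 := by
    intro i
    by_cases hj : i = j
    · subst hj
      simp [hjk]
    · by_cases hk : i = k
      · subst hk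
        simp [hj]
      · simp [hj, hk, h]
  rw [e, Finset.prod_congr rfl fun i _ => e2 i]
  simp only [Finset.prod_mul_distrib, Finset.prod_ite_eq', Finset.mem_univ, if_true]

lemma sum_pi_prod_mul_sum {ℓ : ∀ i, β i → ℝ} (h : ∀ i, ∑ a, ℓ i a = 1) (z : ∀ i, β i → ℝ) :
    ∑ b : ∀ i, β i, (∏ i, ℓ i (b i)) * ∑ j, z j (b j) = ∑ j, ∑ a, ℓ j a * z j a := by
  simp only [Finset.mul_sum]
  rw [Finset.sum_comm]
  exact Finset.sum_congr rfl fun j _ => sum_pi_prod_mul h z j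

/-- The variance of a sum of independent variables, with the individual squared means dropped. -/
lemma sum_pi_prod_mul_sum_sq_le {ℓ : ∀ i, β i → ℝ} (h : ∀ i, ∑ a, ℓ i a = 1)
    (z : ∀ i, β i → ℝ) :
    ∑ b : ∀ i, β i, (∏ i, ℓ i (b i)) * (∑ j, z j (b j)) ^ 2 ≤
      (∑ j, ∑ a, ℓ j a * z j a) ^ 2 + ∑ j, ∑ a, ℓ j a * z j a ^ 2 := by
  have hpair : ∀ j k, ∑ b : ∀ i, β i, (∏ i, ℓ i (b i)) * (z j (b j) * z k (b k)) ≤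
      (∑ a, ℓ j a * z j a) * (∑ a, ℓ k a * z k a) +
        if j = k then ∑ a, ℓ j a * z j a ^ 2 else 0 := by
    intro j k
    by_cases hjk : j = k
    · subst hjk
      have := sum_pi_prod_mul h (fun i a => z i a ^ 2) j
      simp only [← pow_two, this, if_true]
      nlinarith [sq_nonneg (∑ a, ℓ j a * z j a)]
    · rw [sum_pi_prod_mul_mul h z hjk, if_neg hjk, add_zero]
  calc ∑ b : ∀ i, β i, (∏ i, ℓ i (b i)) * (∑ j, z j (b j)) ^ 2
      = ∑ j, ∑ k, ∑ b : ∀ i, β i, (∏ i, ℓ i (b i)) * (z j (b j) * z k (b k)) := by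
        simp only [pow_two, Finset.sum_mul_sum]
        simp only [Finset.mul_sum]
        rw [Finset.sum_comm]
        exact Finset.sum_congr rfl fun _ _ => Finset.sum_comm
    _ ≤ ∑ j, ∑ k, ((∑ a, ℓ j a * z j a) * (∑ a, ℓ k a * z k a) +
        if j = k then ∑ a, ℓ j a * z j a ^ 2 else 0) :=
        Finset.sum_le_sum fun j _ => Finset.sum_le_sum fun k _ => hpair j k
    _ = _ := by
        simp only [Finset.sum_add_distrib, Finset.sum_ite_eq, Finset.mem_univ, if_true, pow_two,
          Finset.sum_mul_sum]

end Products

/-- Boundary configurations on the `n`-th generation of descendants of `v`. -/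
def Bdry (c : Vtx → ℕ) : ℕ → Vtx → Type
  | 0, _ => Bool
  | n + 1, v => ∀ i : Fin (c v), Bdry c n (v ++ [i.1])

instance instFintypeBdry (c : Vtx → ℕ) : ∀ n v, Fintype (Bdry c n v)
  | 0, _ => inferInstanceAs (Fintype Bool)
  | n + 1, v =>
    letI := fun i : Fin (c v) => instFintypeBdry c n (v ++ [i.1])
    inferInstanceAs (Fintype (∀ i : Fin (c v), Bdry c n (v ++ [i.1])))

/-- The probability of a boundary configuration given the spin at `v`. -/
def lik (c : Vtx → ℕ) (θ : Vtx → ℝ) : ∀ n v, Bool → Bdry c n v → ℝ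
  | 0, _ => fun s (b : Bool) => if b = s then 1 else 0
  | n + 1, v => fun s b =>
    ∏ i : Fin (c v), noisy (θ (v ++ [i.1])) (lik c θ n (v ++ [i.1])) s (b i)

lemma sum_bdry_zero {c : Vtx → ℕ} {v : Vtx} (f : Bdry c 0 v → ℝ) :
    ∑ b, f b = f true + f false :=
  Fintype.sum_bool (f : Bool → ℝ)

lemma lik_nonneg {c : Vtx → ℕ} {θ : Vtx → ℝ} (hθ : ∀ v, IsVtx c v → v ≠ [] → 0 < θ v ∧ θ v < 1)
    (n : ℕ) {v : Vtx} (hv : IsVtx c v) (s : Bool) (b : Bdry c n v) : 0 ≤ lik c θ n v s b := by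
  induction n generalizing v s with
  | zero =>
    simp only [lik]
    split_ifs <;> norm_num
  | succ n ih =>
    refine Finset.prod_nonneg fun i _ => ?_
    have hw := hv.child i.2
    have ht := hθ _ hw (by simp)
    exact noisy_nonneg ht.1 ht.2 (fun s b => ih hw s b) _ _

lemma sum_lik (c : Vtx → ℕ) (θ : Vtx → ℝ) (n : ℕ) (v : Vtx) (s : Bool) :
    ∑ b, lik c θ n v s b = 1 := by
  induction n generalizing v s with
  | zero =>
    rw [sum_bdry_zero]
    cases s <;> simp [lik]
  | succ n ih =>
    refine (sum_pi_prod fun (i : Fin (c v)) a =>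
      noisy (θ (v ++ [i.1])) (lik c θ n (v ++ [i.1])) s a).trans ?_
    exact Finset.prod_eq_one fun i _ => sum_noisy (fun s => ih _ s) s

lemma lik_add_pos {c : Vtx → ℕ} {θ : Vtx → ℝ}
    (hθ : ∀ v, IsVtx c v → v ≠ [] → 0 < θ v ∧ θ v < 1) (n : ℕ) {v : Vtx} (hv : IsVtx c v)
    (b : Bdry c n v) (s : Bool) : 0 < lik c θ n v s b + lik c θ n v (!s) b := by
  induction n generalizing v s with
  | zero => cases s <;> cases b <;> simp [lik]
  | succ n ih =>
    have key : ∀ s, 0 < lik c θ (n + 1) v s b := fun s => Finset.prod_pos fun i _ =>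
      have hw := hv.child i.2
      have ht := hθ _ hw (by simp)
      noisy_pos ht.1 ht.2 (fun s b => lik_nonneg hθ n hw s b) s (b i) (ih hw (b i) s)
    exact add_pos (key _) (key _)

lemma lik_succ_pos {c : Vtx → ℕ} {θ : Vtx → ℝ}
    (hθ : ∀ v, IsVtx c v → v ≠ [] → 0 < θ v ∧ θ v < 1) (n : ℕ) {v : Vtx} (hv : IsVtx c v)
    (s : Bool) (b : Bdry c (n + 1) v) : 0 < lik c θ (n + 1) v s b :=
  Finset.prod_pos fun i _ =>
    have hw := hv.child i.2
    have ht := hθ _ hw (by simp)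
    noisy_pos ht.1 ht.2 (fun s b => lik_nonneg hθ n hw s b) s (b i) (lik_add_pos hθ n hw (b i) s)

lemma levelProb_pos {c : Vtx → ℕ} {θ : Vtx → ℝ} (hθ : ∀ v, IsVtx c v → v ≠ [] → 0 < θ v)
    (hc : ∀ v, IsVtx c v → 1 ≤ c v) (n : ℕ) {v : Vtx} (hv : IsVtx c v) :
    0 < levelProb c θ n v := by
  induction n generalizing v with
  | zero => simp [levelProb]
  | succ n ih =>
    have : 0 < levelCond c θ n v := by
      refine Finset.sum_pos (fun i hi => ?_) ⟨0, Finset.mem_range.2 (hc v hv)⟩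
      have hw := hv.child (Finset.mem_range.1 hi)
      exact mul_pos (pow_pos (hθ _ hw (by simp)) 2) (ih hw)
    rw [levelProb_succ]
    positivity

/-- An unbiased linear estimator of the spin at `v` with small second moment. -/
lemma exists_estimator {c : Vtx → ℕ} {θ : Vtx → ℝ}
    (hθ : ∀ v, IsVtx c v → v ≠ [] → 0 < θ v ∧ θ v < 1)
    (hc : ∀ v, IsVtx c v → 1 ≤ c v) (n : ℕ) {v : Vtx} (hv : IsVtx c v) :
    ∃ z : Bdry c n v → ℝ, ∀ s, ∑ b, lik c θ n v s b * z b = sgn s ∧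
      ∑ b, lik c θ n v s b * z b ^ 2 ≤ (levelProb c θ n v)⁻¹ := by
  induction n generalizing v with
  | zero =>
    refine ⟨fun b => sgn b, fun s => ?_⟩
    rw [sum_bdry_zero, sum_bdry_zero]
    cases s <;> simp [lik, levelProb, sgn]
  | succ n ih =>
    have hw : ∀ i : Fin (c v), IsVtx c (v ++ [i.1]) := fun i => hv.child i.2
    choose z hz using fun i => ih (hw i)
    have hS : levelCond c θ n v =
        ∑ i : Fin (c v), θ (v ++ [i.1]) ^ 2 * levelProb c θ n (v ++ [i.1]) :=
      Finset.sum_range fun i => θ (v ++ [i]) ^ 2 * levelProb c θ n (v ++ [i])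
    set S := levelCond c θ n v with hSd
    have hSpos : 0 < S := by
      have h1 := levelProb_pos (fun v hv hne => (hθ v hv hne).1) hc (n + 1) hv
      have h2 := levelCond_nonneg c θ n v
      rw [levelProb_succ] at h1
      rcases h2.lt_or_eq with h | h
      · exact h
      · rw [← h] at h1
        simp at h1
    let w : ∀ i : Fin (c v), Bdry c n (v ++ [i.1]) → ℝ := fun i a =>
      (θ (v ++ [i.1]) * levelProb c θ n (v ++ [i.1]) / S) * z i a
    have hmean : ∀ s (i : Fin (c v)), ∑ a, noisy (θ (v ++ [i.1])) (lik c θ n (v ++ [i.1])) s a *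
        w i a = sgn s * (θ (v ++ [i.1]) ^ 2 * levelProb c θ n (v ++ [i.1]) / S) := by
      intro s i
      have e : ∀ r, ∑ a, lik c θ n (v ++ [i.1]) r a * w i a =
          (θ (v ++ [i.1]) * levelProb c θ n (v ++ [i.1]) / S) * sgn r := by
        intro r
        rw [← (hz i r).1, Finset.mul_sum]
        exact Finset.sum_congr rfl fun a _ => by simp only [w]; ring
      rw [sum_noisy_mul, e, e]
      cases s <;> simp [sgn] <;> ring
    have hsq : ∀ s (i : Fin (c v)), ∑ a, noisy (θ (v ++ [i.1])) (lik c θ n (v ++ [i.1])) s a *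
        w i a ^ 2 ≤ θ (v ++ [i.1]) ^ 2 * levelProb c θ n (v ++ [i.1]) / S ^ 2 := by
      intro s i
      have hu := levelProb_pos (fun v hv hne => (hθ v hv hne).1) hc n (hw i)
      have ht := hθ _ (hw i) (by simp)
      have e : ∀ r, ∑ a, lik c θ n (v ++ [i.1]) r a * w i a ^ 2 ≤
          θ (v ++ [i.1]) ^ 2 * levelProb c θ n (v ++ [i.1]) / S ^ 2 := by
        intro r
        have h1 := mul_le_mul_of_nonneg_left (hz i r).2
          (sq_nonneg (θ (v ++ [i.1]) * levelProb c θ n (v ++ [i.1]) / S))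
        rw [Finset.mul_sum] at h1
        refine le_of_eq_of_le (Finset.sum_congr rfl fun a _ => by simp only [w]; ring)
          (h1.trans_eq ?_)
        field_simp
      rw [sum_noisy_mul _ _ s fun a => w i a ^ 2]
      have h1 := mul_le_mul_of_nonneg_left (e s)
        (by linarith [ht.1] : 0 ≤ (1 + θ (v ++ [i.1])) / 2)
      have h2 := mul_le_mul_of_nonneg_left (e (!s))
        (by linarith [ht.2] : 0 ≤ (1 - θ (v ++ [i.1])) / 2)
      linarith
    have hsum : ∑ i : Fin (c v), θ (v ++ [i.1]) ^ 2 * levelProb c θ n (v ++ [i.1]) / S = 1 := by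
      rw [← Finset.sum_div, ← hS, div_self hSpos.ne']
    refine ⟨fun b => ∑ i, w i (b i), fun s => ⟨?_, ?_⟩⟩
    · refine (sum_pi_prod_mul_sum (fun i => sum_noisy (fun s => sum_lik c θ n _ s) s) w).trans ?_
      rw [Finset.sum_congr rfl fun i _ => hmean s i, ← Finset.mul_sum, hsum, mul_one]
    · refine (sum_pi_prod_mul_sum_sq_le
        (fun i => sum_noisy (fun s => sum_lik c θ n _ s) s) w).trans ?_
      rw [Finset.sum_congr rfl fun i _ => hmean s i, ← Finset.mul_sum, hsum, mul_one]
      have h1 : sgn s ^ 2 = 1 := by cases s <;> simp [sgn]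
      have h2 := Finset.sum_le_sum fun i (_ : i ∈ Finset.univ) => hsq s i
      rw [← Finset.sum_div, ← hS] at h2
      rw [h1, levelProb_succ, ← hSd]
      have h3 : (S / (1 + S))⁻¹ = 1 + S / S ^ 2 := by
        field_simp
        ring
      linarith

/-- The Hellinger affinity at the root dominates a percolation recursion, and hence is controlled
by the effective conductance. -/
lemma exp_neg_le_affinity_sq {c : Vtx → ℕ} {θ : Vtx → ℝ} {κ : ℝ} (hκ : 0 < κ)
    (hθ : ∀ v, IsVtx c v → v ≠ [] → 0 < θ v ∧ θ v < 1 ∧ 2 * κ ≤ 1 - θ v ^ 2) (n : ℕ) {v : Vtx}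
    (hv : IsVtx c v) :
    Real.exp (-(levelCond c θ n v / κ)) ≤ affinity (lik c θ (n + 1) v) ^ 2 := by
  have hθ' := fun v hv hne => And.intro (hθ v hv hne).1 (hθ v hv hne).2.1
  induction n using Nat.strong_induction_on generalizing v with
  | _ n ih =>
  have hprod : affinity (lik c θ (n + 1) v) =
      ∏ i : Fin (c v), affinity (noisy (θ (v ++ [i.1])) (lik c θ n (v ++ [i.1]))) :=
    affinity_pi fun i s a =>
      have hw := hv.child i.2
      noisy_nonneg (hθ' _ hw (by simp)).1 (hθ' _ hw (by simp)).2
        (fun s a => lik_nonneg hθ' n hw s a) s a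
  have hS : -(levelCond c θ n v / κ) =
      ∑ i : Fin (c v), -(θ (v ++ [i.1]) ^ 2 * (levelProb c θ n (v ++ [i.1]) / κ)) := by
    rw [levelCond, Finset.sum_range, Finset.sum_neg_distrib, Finset.sum_div]
    simp only [mul_div_assoc]
  rw [hprod, ← Finset.prod_pow, hS, Real.exp_sum]
  refine Finset.prod_le_prod (fun _ _ => (Real.exp_pos _).le) fun i _ => ?_
  have hw := hv.child i.2
  obtain ⟨h0, h1, h2⟩ := hθ _ hw (by simp)
  refine le_trans ?_ (affinity_noisy h0 h1 (fun s a => lik_nonneg hθ' n hw s a)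
    (fun s => sum_lik c θ n _ s))
  cases n with
  | zero =>
    have h3 := exp_neg_div_le_one_sub (sq_nonneg (θ (v ++ [i.1]))) hκ h2
    have h4 : affinity (lik c θ 0 (v ++ [i.1])) = 0 := by
      rw [affinity, sum_bdry_zero]
      simp [lik]
    rw [h4, levelProb]
    linarith
  | succ n =>
    have h3 := exp_neg_le_of_series (sq_nonneg (θ (v ++ [i.1]))) hκ h2
      (div_nonneg (levelCond_nonneg c θ n (v ++ [i.1])) hκ.le)
    have h4 := mul_le_mul_of_nonneg_left (ih n (Nat.lt_succ_self n) hw)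
      (sq_nonneg (θ (v ++ [i.1])))
    have h5 : levelProb c θ (n + 1) (v ++ [i.1]) / κ =
        levelCond c θ n (v ++ [i.1]) / κ / (1 + κ * (levelCond c θ n (v ++ [i.1]) / κ)) := by
      rw [levelProb_succ, mul_div_cancel₀ _ hκ.ne', div_right_comm]
    rw [h5]
    linarith

section Deviation

variable {α : Type*} [Fintype α] {ℓ : Bool → α → ℝ}

/-- The probability, under a uniform prior, that the log-likelihood ratio exceeds `ε`. -/
def deviation (ℓ : Bool → α → ℝ) (ε : ℝ) : ℝ :=
  ∑ a, if ε < |Real.log (ℓ true a / ℓ false a)| then (ℓ true a + ℓ false a) / 2 else 0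

lemma deviation_nonneg (h0 : ∀ s a, 0 < ℓ s a) (ε : ℝ) : 0 ≤ deviation ℓ ε :=
  Finset.sum_nonneg fun a _ => by
    have := h0 true a
    have := h0 false a
    split_ifs <;> positivity

lemma sqrt_sub_sq_ge {x y ε : ℝ} (hx : 0 < x) (hy : 0 < y) (hε : 0 < ε)
    (h : ε < Real.log (x / y)) :
    (1 - Real.exp (-(ε / 2))) ^ 2 * ((x + y) / 2) ≤ 2 * ((x + y) / 2 - √(x * y)) := by
  rw [Real.lt_log_iff_exp_lt (div_pos hx hy), lt_div_iff₀ hy] at h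
  have hE : Real.exp (-(ε / 2)) < 1 := Real.exp_lt_one_iff.2 (by linarith)
  have hE0 := Real.exp_pos (-(ε / 2))
  have hx2 := Real.sq_sqrt hx.le
  have hy2 := Real.sq_sqrt hy.le
  rw [Real.sqrt_mul hx.le]
  have hyx : √y ≤ Real.exp (-(ε / 2)) * √x := by
    refine Real.sqrt_le_iff.2 ⟨by positivity, ?_⟩
    rw [mul_pow, hx2, ← Real.exp_nat_mul]
    have e : Real.exp (((2 : ℕ) : ℝ) * -(ε / 2)) * Real.exp ε = 1 := by
      rw [← Real.exp_add]
      norm_num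
      ring
    have := mul_le_mul_of_nonneg_left h.le (Real.exp_pos (((2 : ℕ) : ℝ) * -(ε / 2))).le
    rw [← mul_assoc, e, one_mul] at this
    exact this
  have hx0 := Real.sqrt_pos.2 hx
  have hy0 := Real.sqrt_pos.2 hy
  set a := √x
  set b := √y
  have h1 : ((1 - Real.exp (-(ε / 2))) * a) ^ 2 ≤ (a - b) ^ 2 :=
    pow_le_pow_left₀ (by nlinarith) (by linarith) 2
  have h2 : b ^ 2 ≤ a ^ 2 := pow_le_pow_left₀ hy0.le (by nlinarith) 2
  have h3 := mul_le_mul_of_nonneg_left h2 (sq_nonneg (1 - Real.exp (-(ε / 2))))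
  rw [← hx2, ← hy2]
  nlinarith

lemma deviation_le (h0 : ∀ s a, 0 < ℓ s a) (h1 : ∀ s, ∑ a, ℓ s a = 1) {ε : ℝ} (hε : 0 < ε) :
    (1 - Real.exp (-(ε / 2))) ^ 2 * deviation ℓ ε ≤ 2 * (1 - affinity ℓ) := by
  have hR : 2 * (1 - affinity ℓ) =
      ∑ a, 2 * ((ℓ true a + ℓ false a) / 2 - √(ℓ true a * ℓ false a)) := by
    rw [← Finset.mul_sum, Finset.sum_sub_distrib, ← Finset.sum_div, Finset.sum_add_distrib, h1,
      h1, affinity]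
    norm_num
  rw [hR, deviation, Finset.mul_sum]
  refine Finset.sum_le_sum fun a _ => ?_
  have hx := h0 true a
  have hy := h0 false a
  split_ifs with h
  · rcases lt_abs.1 h with h | h
    · exact sqrt_sub_sq_ge hx hy hε h
    · rw [← Real.log_inv, inv_div] at h
      have := sqrt_sub_sq_ge hy hx hε h
      rwa [add_comm, mul_comm (ℓ false a)] at this
  · have := sq_nonneg (√(ℓ true a) - √(ℓ false a))
    rw [sub_sq, Real.sq_sqrt hx.le, Real.sq_sqrt hy.le, mul_assoc, ← Real.sqrt_mul hx.le] at this
    linarith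

lemma sq_sub_le_of_log_le {x y ε : ℝ} (hx : 0 < x) (hy : 0 < y)
    (h : |Real.log (x / y)| ≤ ε) : ((x - y) / (x + y)) ^ 2 ≤ (Real.exp ε - 1) ^ 2 := by
  obtain ⟨h1, h2⟩ := abs_le.1 h
  rw [Real.log_le_iff_le_exp (div_pos hx hy), div_le_iff₀ hy] at h2
  have h3 : Real.log (y / x) ≤ ε := by
    rw [← inv_div, Real.log_inv]
    linarith
  rw [Real.log_le_iff_le_exp (div_pos hy hx), div_le_iff₀ hx] at h3
  have hE : 1 ≤ Real.exp ε := Real.one_le_exp ((abs_nonneg _).trans h)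
  refine sq_le_sq' ?_ ?_
  · rw [le_div_iff₀ (by linarith)]
    nlinarith
  · rw [div_le_iff₀ (by linarith)]
    nlinarith

lemma inv_le_of_estimator (h0 : ∀ s a, 0 < ℓ s a) (h1 : ∀ s, ∑ a, ℓ s a = 1) {z : α → ℝ} {q : ℝ}
    (hq : 0 < q) (hz : ∀ s, ∑ a, ℓ s a * z a = sgn s ∧ ∑ a, ℓ s a * z a ^ 2 ≤ q) (ε : ℝ) :
    q⁻¹ ≤ (Real.exp ε - 1) ^ 2 + deviation ℓ ε := by
  have hpt : ∀ a, ℓ true a * z a - ℓ false a * z a ≤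
      (ℓ true a * z a ^ 2 + ℓ false a * z a ^ 2) / (2 * q) +
        q * ((Real.exp ε - 1) ^ 2 * ((ℓ true a + ℓ false a) / 2) +
          if ε < |Real.log (ℓ true a / ℓ false a)| then (ℓ true a + ℓ false a) / 2 else 0) := by
    intro a
    have hx := h0 true a
    have hy := h0 false a
    set m := (ℓ true a - ℓ false a) / (ℓ true a + ℓ false a) with hm
    have hA : 0 < ℓ true a + ℓ false a := by linarith
    have hD : ℓ true a * z a - ℓ false a * z a = (ℓ true a + ℓ false a) * (m * z a) := by
      rw [hm]
      field_simp
    have hm2 : (ℓ true a + ℓ false a) / 2 * m ^ 2 ≤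
        (Real.exp ε - 1) ^ 2 * ((ℓ true a + ℓ false a) / 2) +
          if ε < |Real.log (ℓ true a / ℓ false a)| then (ℓ true a + ℓ false a) / 2 else 0 := by
      split_ifs with h
      · have : m ^ 2 ≤ 1 := by
          rw [hm, div_pow, div_le_one (by positivity)]
          nlinarith
        nlinarith [sq_nonneg (Real.exp ε - 1), mul_nonneg (sq_nonneg (Real.exp ε - 1)) hA.le]
      · have := mul_le_mul_of_nonneg_left (sq_sub_le_of_log_le hx hy (not_lt.1 h))
          (half_pos hA).le
        linarith
    have hamgm : m * z a ≤ z a ^ 2 / (2 * q) + q * m ^ 2 / 2 := by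
      rw [div_add_div _ _ (by positivity) two_ne_zero, le_div_iff₀ (by positivity)]
      nlinarith [sq_nonneg (z a - q * m)]
    rw [hD]
    have h2 := mul_le_mul_of_nonneg_left hamgm hA.le
    have h3 := mul_le_mul_of_nonneg_left hm2 hq.le
    have e : (ℓ true a + ℓ false a) * (z a ^ 2 / (2 * q) + q * m ^ 2 / 2) =
        (ℓ true a * z a ^ 2 + ℓ false a * z a ^ 2) / (2 * q) +
          q * ((ℓ true a + ℓ false a) / 2 * m ^ 2) := by ring
    linarith
  have hsum := Finset.sum_le_sum fun a (_ : a ∈ Finset.univ) => hpt a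
  rw [Finset.sum_sub_distrib, Finset.sum_add_distrib, ← Finset.sum_div, Finset.sum_add_distrib,
    ← Finset.mul_sum, Finset.sum_add_distrib, ← Finset.mul_sum, ← Finset.sum_div,
    Finset.sum_add_distrib, h1, h1, (hz true).1, (hz false).1] at hsum
  change _ ≤ _ + q * (_ + deviation ℓ ε) at hsum
  have h2 : (∑ a, ℓ true a * z a ^ 2 + ∑ a, ℓ false a * z a ^ 2) / (2 * q) ≤ 1 := by
    rw [div_le_one (by positivity)]
    linarith [(hz true).2, (hz false).2]
  simp only [sgn, if_true, Bool.false_eq_true, if_false] at hsum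
  rw [inv_le_iff_one_le_mul₀ hq]
  linarith

end Deviation

/-- Spin configurations on the first `n` generations of the subtree rooted at `v`. -/
def SubConf (c : Vtx → ℕ) : ℕ → Vtx → Type
  | 0, _ => Bool
  | n + 1, v => Bool × ∀ i : Fin (c v), SubConf c n (v ++ [i.1])

instance instFintypeSubConf (c : Vtx → ℕ) : ∀ n v, Fintype (SubConf c n v)
  | 0, _ => inferInstanceAs (Fintype Bool)
  | n + 1, v =>
    letI := fun i : Fin (c v) => instFintypeSubConf c n (v ++ [i.1])
    inferInstanceAs (Fintype (Bool × ∀ i : Fin (c v), SubConf c n (v ++ [i.1])))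

namespace SubConf

variable {c : Vtx → ℕ}

/-- The spin at the root of the subtree. -/
def top : ∀ {n v}, SubConf c n v → Bool
  | 0, _ => fun x => x
  | _ + 1, _ => fun x => x.1

/-- The spins on the last generation. -/
def bdry : ∀ {n v}, SubConf c n v → Bdry c n v
  | 0, _ => fun x => x
  | _ + 1, _ => fun x i => (x.2 i).bdry

/-- The spin at the descendant reached by following a list of child indices. -/
def look : ∀ {n v}, SubConf c n v → List ℕ → Bool
  | 0, _ => fun x _ => x
  | _ + 1, v => fun x l => match l with
    | [] => x.1
    | i :: l => if h : i < c v then (x.2 ⟨i, h⟩).look l else true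

/-- The restriction of a configuration to a subtree. -/
def restrict (c : Vtx → ℕ) (η : Vtx → Bool) : ∀ n v, SubConf c n v
  | 0, v => η v
  | n + 1, v => (η v, fun i => restrict c η n (v ++ [i.1]))

/-- The transition probability of the tree-indexed Markov chain across an edge. -/
def step (t : ℝ) (r s : Bool) : ℝ := if r = s then (1 + t) / 2 else (1 - t) / 2

/-- The law of a configuration given the spin at its top. -/
def prob (θ : Vtx → ℝ) : ∀ {n v}, SubConf c n v → ℝ
  | 0, _ => fun _ => 1
  | _ + 1, v => fun x => ∏ i : Fin (c v), step (θ (v ++ [i.1])) x.1 (x.2 i).top * (x.2 i).prob θ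

lemma sum_step_mul (t : ℝ) (ℓ : Bool → ℝ) (s : Bool) :
    ∑ r, step t s r * ℓ r = (1 + t) / 2 * ℓ s + (1 - t) / 2 * ℓ (!s) := by
  cases s <;> simp [step]
  ring

lemma sum_prob (θ : Vtx → ℝ) (n : ℕ) (v : Vtx) (s : Bool) (b : Bdry c n v) :
    (∑ x : SubConf c n v, if x.bdry = b ∧ x.top = s then x.prob θ else 0) = lik c θ n v s b := by
  induction n generalizing v s with
  | zero =>
    have e : ∀ r : Bool, (∑ x : Bool, if x = r ∧ x = s then (1 : ℝ) else 0) =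
        if r = s then 1 else 0 := by
      intro r
      simp only [ite_and, Finset.sum_ite_eq', Finset.mem_univ, if_true]
    exact (Finset.sum_congr rfl fun (x : Bool) _ =>
      @if_congr _ _ _ (_) (_) _ _ _ _ Iff.rfl rfl rfl).trans (e b)
  | succ n ih =>
    revert b
    intro (b : ∀ i : Fin (c v), Bdry c n (v ++ [i.1]))
    have hedge : ∀ i : Fin (c v), noisy (θ (v ++ [i.1])) (lik c θ n (v ++ [i.1])) s (b i) =
        ∑ x : SubConf c n (v ++ [i.1]),
          if x.bdry = b i then step (θ (v ++ [i.1])) s x.top * x.prob θ else 0 := by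
      intro i
      rw [noisy, ← sum_step_mul _ fun r => lik c θ n (v ++ [i.1]) r (b i)]
      simp only [← ih, Finset.mul_sum]
      rw [Finset.sum_comm]
      refine Finset.sum_congr rfl fun x _ => ?_
      by_cases h : x.bdry = b i <;> simp [h]
    have hsum : (∑ x : Bool × ∀ i : Fin (c v), SubConf c n (v ++ [i.1]),
        if (∀ i, (x.2 i).bdry = b i) ∧ x.1 = s then
          ∏ i : Fin (c v), step (θ (v ++ [i.1])) x.1 (x.2 i).top * (x.2 i).prob θ else 0) =
        ∏ i : Fin (c v), noisy (θ (v ++ [i.1])) (lik c θ n (v ++ [i.1])) s (b i) := by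
      rw [Finset.prod_congr rfl fun i _ => hedge i,
        ← sum_pi_prod fun (i : Fin (c v)) (x : SubConf c n (v ++ [i.1])) =>
          if x.bdry = b i then step (θ (v ++ [i.1])) s x.top * x.prob θ else 0,
        Fintype.sum_prod_type_right]
      refine Finset.sum_congr rfl fun x _ => ?_
      by_cases h : ∀ i, (x i).bdry = b i
      · simp [h]
      · rw [Finset.sum_eq_zero fun r _ => by simp [h]]
        obtain ⟨i, hi⟩ := not_forall.1 h
        exact (Finset.prod_eq_zero (Finset.mem_univ i) (if_neg hi)).symm
    exact (Finset.sum_congr rfl fun x _ =>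
      if_congr (and_congr funext_iff Iff.rfl) rfl rfl).trans hsum

lemma sum_mul_prob (θ : Vtx → ℝ) (n : ℕ) (v : Vtx) (G : Bdry c n v → ℝ) :
    ∑ x : SubConf c n v, G x.bdry * x.prob θ =
      ∑ b, G b * (lik c θ n v true b + lik c θ n v false b) := by
  have e : ∀ b, lik c θ n v true b + lik c θ n v false b =
      ∑ x : SubConf c n v, if x.bdry = b then x.prob θ else 0 := by
    intro b
    rw [← sum_prob, ← sum_prob, ← Finset.sum_add_distrib]
    refine Finset.sum_congr rfl fun x _ => ?_
    by_cases h : x.bdry = b <;> cases x.top <;> simp [h]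
  simp only [e, Finset.mul_sum, mul_ite, mul_zero]
  rw [Finset.sum_comm]
  simp

lemma restrict_eq_of_look {n : ℕ} {v : Vtx} (x : SubConf c n v) (η : Vtx → Bool)
    (h : ∀ l, η (v ++ l) = x.look l) : restrict c η n v = x := by
  induction n generalizing v with
  | zero => exact (congrArg η (List.append_nil v)).symm.trans (h [])
  | succ n ih =>
    refine Prod.ext ((congrArg η (List.append_nil v)).symm.trans (h []))
      (funext fun i => ih _ fun l => ?_)
    have := h (i.1 :: l)
    simp only [look, i.2, dif_pos] at this
    rw [← this]
    simp

lemma lt_of_isVtx_cons {v : Vtx} {i : ℕ} {l : List ℕ} (h : IsVtx c (v ++ i :: l)) : i < c v := by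
  have := h.take (v.length + 1)
  rw [List.append_cons, List.take_append_of_le_length (by simp),
    List.take_of_length_le (by simp)] at this
  exact this.of_concat.2

lemma restrict_eq_iff {η η' : Vtx → Bool} {n : ℕ} {v : Vtx} (hv : IsVtx c v) :
    restrict c η n v = restrict c η' n v ↔
      ∀ l : List ℕ, IsVtx c (v ++ l) → l.length ≤ n → η (v ++ l) = η' (v ++ l) := by
  induction n generalizing v with
  | zero =>
    change η v = η' v ↔ _
    constructor
    · intro h l _ hl
      obtain rfl := List.length_eq_zero_iff.1 (Nat.le_zero.1 hl)
      simpa using h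
    · intro h
      simpa using h [] (by simpa using hv) le_rfl
  | succ n ih =>
    refine (Prod.ext_iff.trans (and_congr Iff.rfl funext_iff)).trans ?_
    change (η v = η' v ∧ ∀ i : Fin (c v),
      restrict c η n (v ++ [i.1]) = restrict c η' n (v ++ [i.1])) ↔ _
    constructor
    · rintro ⟨h1, h2⟩ (_ | ⟨i, l⟩) hl hn
      · simpa using h1
      · have hi := lt_of_isVtx_cons hl
        have := (ih (hv.child hi)).1 (h2 ⟨i, hi⟩) l (by simpa using hl) (by simpa using hn)
        simpa using this
    · intro h
      refine ⟨by simpa using h [] (by simpa using hv) (Nat.zero_le _), fun i =>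
        (ih (hv.child i.2)).2 fun l hl hn => ?_⟩
      simpa using h (i.1 :: l) (by simpa using hl) (by simpa using hn)

lemma bdry_restrict_eq_iff {η η' : Vtx → Bool} {n : ℕ} {v : Vtx} (hv : IsVtx c v) :
    (restrict c η n v).bdry = (restrict c η' n v).bdry ↔
      ∀ l : List ℕ, IsVtx c (v ++ l) → l.length = n → η (v ++ l) = η' (v ++ l) := by
  induction n generalizing v with
  | zero =>
    change η v = η' v ↔ _
    constructor
    · intro h l _ hl
      obtain rfl := List.length_eq_zero_iff.1 hl
      simpa using h
    · intro h
      simpa using h [] (by simpa using hv) rfl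
  | succ n ih =>
    refine funext_iff.trans ?_
    change (∀ i : Fin (c v), (restrict c η n (v ++ [i.1])).bdry =
      (restrict c η' n (v ++ [i.1])).bdry) ↔ _
    constructor
    · rintro h2 (_ | ⟨i, l⟩) hl hn
      · simp at hn
      · have hi := lt_of_isVtx_cons hl
        have := (ih (hv.child hi)).1 (h2 ⟨i, hi⟩) l (by simpa using hl) (by simpa using hn)
        simpa using this
    · intro h i
      refine (ih (hv.child i.2)).2 fun l hl hn => ?_
      simpa using h (i.1 :: l) (by simpa using hl) (by simpa using hn)

lemma top_restrict (η : Vtx → Bool) (n : ℕ) (v : Vtx) : (restrict c η n v).top = η v := by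
  cases n <;> rfl

end SubConf

section Configurations

variable {c : Vtx → ℕ}

lemma mem_lev {n : ℕ} {w : Vtx} : w ∈ lev c n ↔ IsVtx c w ∧ w.length = n := by
  induction n generalizing w with
  | zero =>
    simp only [lev, Finset.mem_singleton, List.length_eq_zero_iff]
    exact ⟨fun h => ⟨h ▸ IsVtx.root, h⟩, fun h => h.2⟩
  | succ n ih =>
    simp only [lev, Finset.mem_biUnion, Finset.mem_image, Finset.mem_range, ih]
    constructor
    · rintro ⟨v, ⟨hv, hn⟩, i, hi, rfl⟩
      exact ⟨hv.child hi, by simp [hn]⟩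
    · rintro ⟨hw, hn⟩
      obtain ⟨v, i, hv, hi, rfl⟩ := hw.exists_of_ne_nil (List.ne_nil_of_length_eq_add_one hn)
      exact ⟨v, ⟨hv, by simpa using hn⟩, i, hi, rfl⟩

lemma mem_verts {N : ℕ} {w : Vtx} : w ∈ verts c N ↔ IsVtx c w ∧ w.length ≤ N := by
  simp only [verts, Finset.mem_biUnion, Finset.mem_range, mem_lev, Nat.lt_succ_iff]
  exact ⟨fun ⟨n, hn, hw, h⟩ => ⟨hw, h ▸ hn⟩, fun ⟨hw, h⟩ => ⟨_, h, hw, rfl⟩⟩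

lemma prod_lev_succ (n : ℕ) (g : Vtx → ℝ) :
    ∏ w ∈ lev c (n + 1), g w = ∏ v ∈ lev c n, ∏ i : Fin (c v), g (v ++ [i.1]) := by
  rw [lev, Finset.prod_biUnion]
  · refine Finset.prod_congr rfl fun v _ => ?_
    rw [Finset.prod_image fun i _ j _ h => by simpa using h,
      Finset.prod_range fun i => g (v ++ [i])]
  · intro v _ w _ hvw
    refine Finset.disjoint_left.2 fun u hu hu' => hvw ?_
    obtain ⟨i, -, rfl⟩ := Finset.mem_image.1 hu
    obtain ⟨j, -, h⟩ := Finset.mem_image.1 hu'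
    exact (List.append_inj' h.symm rfl).1

lemma prod_prob_restrict (θ : Vtx → ℝ) (η : Vtx → Bool) (n k : ℕ) :
    ∏ v ∈ lev c k, (SubConf.restrict c η n v).prob θ = ∏ j ∈ Finset.range n,
      ∏ w ∈ lev c (k + j + 1), SubConf.step (θ w) (η w.dropLast) (η w) := by
  induction n generalizing k with
  | zero => exact Finset.prod_const_one
  | succ n ih =>
    have e : ∀ v, (SubConf.restrict c η (n + 1) v).prob θ = ∏ i : Fin (c v),
        SubConf.step (θ (v ++ [i.1])) (η (v ++ [i.1]).dropLast) (η (v ++ [i.1])) *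
          (SubConf.restrict c η n (v ++ [i.1])).prob θ := by
      intro v
      refine Finset.prod_congr rfl fun i _ => ?_
      rw [List.dropLast_concat, ← SubConf.top_restrict (c := c) η n (v ++ [i.1])]
      rfl
    rw [Finset.prod_congr rfl fun v _ => e v, ← prod_lev_succ k fun w =>
      SubConf.step (θ w) (η w.dropLast) (η w) * (SubConf.restrict c η n w).prob θ,
      Finset.prod_mul_distrib, ih, Finset.prod_range_succ', mul_comm]
    simp only [add_zero, add_assoc, add_comm 1]

lemma exp_mul_sgn (x : ℝ) (r s : Bool) :
    Real.exp (x * sgn r * sgn s) = 2 * Real.cosh x * SubConf.step (Real.tanh x) r s := by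
  have hx := (Real.cosh_pos x).ne'
  have h1 : 2 * Real.cosh x * ((1 + Real.tanh x) / 2) = Real.exp x := by
    rw [Real.tanh_eq_sinh_div_cosh, ← Real.cosh_add_sinh]
    field_simp
  have h2 : 2 * Real.cosh x * ((1 - Real.tanh x) / 2) = Real.exp (-x) := by
    rw [Real.tanh_eq_sinh_div_cosh, ← Real.cosh_sub_sinh]
    field_simp
  cases r <;> cases s <;> simp [sgn, SubConf.step, h1, h2]

variable {N : ℕ}

/-- The extension of a configuration by plus spins. -/
def Conf.extend (σ : Conf c N) (w : Vtx) : Bool := if h : w ∈ verts c N then σ ⟨w, h⟩ else true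

lemma spin_eq_sgn (σ : Conf c N) (w : Vtx) : spin c N σ w = sgn (σ.extend w) := by
  by_cases h : w ∈ verts c N <;> simp [spin, Conf.extend, sgn, h]

/-- A configuration on the truncated tree, as a recursive family. -/
def Conf.toSub (σ : Conf c N) : SubConf c N [] := SubConf.restrict c σ.extend N []

lemma Conf.toSub_bijective : Function.Bijective (Conf.toSub (c := c) (N := N)) := by
  constructor
  · intro σ τ h
    have := (SubConf.restrict_eq_iff IsVtx.root).1 h
    funext ⟨w, hw⟩
    have e := this w (mem_verts.1 hw).1 (mem_verts.1 hw).2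
    simpa [Conf.extend, hw] using e
  · intro x
    refine ⟨fun w => x.look w.1, Eq.trans ?_ (x.restrict_eq_of_look x.look fun l => rfl)⟩
    refine (SubConf.restrict_eq_iff IsVtx.root).2 fun l hl hn => ?_
    exact dif_pos (mem_verts.2 ⟨hl, hn⟩)

lemma Conf.bdry_toSub_eq_iff (τ σ : Conf c N) :
    (∀ x : {v // v ∈ verts c N}, x.1 ∈ lev c N → τ x = σ x) ↔ τ.toSub.bdry = σ.toSub.bdry := by
  refine Iff.trans ?_ (SubConf.bdry_restrict_eq_iff IsVtx.root).symm
  constructor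
  · intro h l hl hn
    have hm : l ∈ verts c N := mem_verts.2 ⟨hl, hn.le⟩
    simpa [Conf.extend, hm] using h ⟨l, hm⟩ (mem_lev.2 ⟨hl, hn⟩)
  · rintro h ⟨l, hm⟩ hx
    simpa [Conf.extend, hm] using h l (mem_lev.1 hx).1 (mem_lev.1 hx).2

lemma Conf.spin_nil_eq_iff (τ : Conf c N) (s : Bool) : spin c N τ [] = sgn s ↔ τ.toSub.top = s := by
  rw [spin_eq_sgn, Conf.toSub, SubConf.top_restrict]
  cases τ.extend [] <;> cases s <;> norm_num [sgn]

variable {J : Vtx → ℝ} {β : ℝ}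

lemma exists_wt_eq (c : Vtx → ℕ) (J : Vtx → ℝ) (β : ℝ) (N : ℕ) :
    ∃ C, 0 < C ∧ ∀ σ : Conf c N, wt c J β N σ =
      C * σ.toSub.prob fun v => Real.tanh (β * J v) := by
  refine ⟨∏ w ∈ (Finset.range N).biUnion fun n => lev c (n + 1), 2 * Real.cosh (β * J w),
    Finset.prod_pos fun w _ => mul_pos two_pos (Real.cosh_pos _), fun σ => ?_⟩
  simp only [wt, spin_eq_sgn, exp_mul_sgn, Finset.prod_mul_distrib]
  congr 1
  have h := prod_prob_restrict (c := c) (fun v => Real.tanh (β * J v)) σ.extend N 0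
  rw [lev, Finset.prod_singleton] at h
  rw [Conf.toSub, h, Finset.prod_biUnion]
  · simp only [zero_add]
  · intro m _ n _ hmn
    refine Finset.disjoint_left.2 fun u hu hu' => hmn ?_
    exact Nat.succ_injective ((mem_lev.1 hu).2.symm.trans (mem_lev.1 hu').2)

lemma sum_wt_of_bdry {C : ℝ}
    (hC : ∀ σ : Conf c N, wt c J β N σ = C * σ.toSub.prob fun v => Real.tanh (β * J v))
    (σ : Conf c N) (s : Bool) :
    (∑ τ : Conf c N, if (∀ x : {v // v ∈ verts c N}, x.1 ∈ lev c N → τ x = σ x)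
      ∧ spin c N τ [] = sgn s then wt c J β N τ else 0) =
      C * lik c (fun v => Real.tanh (β * J v)) N [] s σ.toSub.bdry := by
  rw [← SubConf.sum_prob, ← Conf.toSub_bijective.sum_comp fun x : SubConf c N [] =>
    if x.bdry = σ.toSub.bdry ∧ x.top = s then x.prob (fun v => Real.tanh (β * J v)) else 0,
    Finset.mul_sum]
  refine Finset.sum_congr rfl fun τ _ => ?_
  simp only [Conf.bdry_toSub_eq_iff, Conf.spin_nil_eq_iff, hC, mul_ite, mul_zero]

lemma expectation_eq_deviation (c : Vtx → ℕ) (J : Vtx → ℝ) (β : ℝ) (N : ℕ) (ε : ℝ) :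
    (∑ σ : Conf c N, if ε < |XoOf c J β N σ| then wt c J β N σ else 0) /
      (∑ σ : Conf c N, wt c J β N σ) =
      deviation (lik c (fun v => Real.tanh (β * J v)) N []) ε := by
  obtain ⟨C, hC0, hC⟩ := exists_wt_eq c J β N
  set θ : Vtx → ℝ := fun v => Real.tanh (β * J v)
  have hX : ∀ σ : Conf c N, XoOf c J β N σ =
      Real.log (lik c θ N [] true σ.toSub.bdry / lik c θ N [] false σ.toSub.bdry) := by
    intro σ
    have ht := sum_wt_of_bdry hC σ true
    have hf := sum_wt_of_bdry hC σ false
    simp only [sgn, if_true, Bool.false_eq_true, if_false] at ht hf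
    rw [XoOf, ht, hf, mul_div_mul_left _ _ hC0.ne']
  have hsum : ∀ G : Bdry c N [] → ℝ, ∑ σ : Conf c N, G σ.toSub.bdry * wt c J β N σ =
      C * ∑ b, G b * (lik c θ N [] true b + lik c θ N [] false b) := by
    intro G
    rw [← SubConf.sum_mul_prob, ← Conf.toSub_bijective.sum_comp fun x : SubConf c N [] =>
      G x.bdry * x.prob θ, Finset.mul_sum]
    refine Finset.sum_congr rfl fun τ _ => ?_
    rw [hC]
    ring
  have hden : ∑ σ : Conf c N, wt c J β N σ = C * 2 := by
    have := hsum fun _ => 1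
    simp only [one_mul, Finset.sum_add_distrib, sum_lik] at this
    rw [this]
    norm_num
  have hnum := hsum fun b =>
    if ε < |Real.log (lik c θ N [] true b / lik c θ N [] false b)| then 1 else 0
  simp only [ite_mul, one_mul, zero_mul, ← hX] at hnum
  rw [hnum, hden, mul_div_mul_left _ _ hC0.ne', deviation, Finset.sum_div]
  refine Finset.sum_congr rfl fun b _ => ?_
  rw [ite_div, zero_div]

end Configurations

section Criterion

variable {c : Vtx → ℕ} {θ : Vtx → ℝ}

lemma limCond_eq_zero_of_tendsto (hθ : ∀ v, IsVtx c v → v ≠ [] → 0 < θ v ∧ θ v < 1)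
    (hc : ∀ v, IsVtx c v → 1 ≤ c v)
    (h : ∀ ε : ℝ, 0 < ε → Filter.Tendsto (fun n => deviation (lik c θ (n + 1) []) ε)
      Filter.atTop (nhds 0)) : limCond c θ [] = 0 := by
  have hle : ∀ ε : ℝ, 0 < ε → limProb c θ [] ≤ (Real.exp ε - 1) ^ 2 := by
    intro ε hε
    have hl := (Filter.tendsto_add_atTop_iff_nat 1).2 (tendsto_levelProb c θ [])
    have hr := (h ε hε).const_add ((Real.exp ε - 1) ^ 2)
    rw [add_zero] at hr
    refine le_of_tendsto_of_tendsto' hl hr fun n => ?_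
    obtain ⟨z, hz⟩ := exists_estimator hθ hc (n + 1) IsVtx.root
    have hp := levelProb_pos (fun v hv hne => (hθ v hv hne).1) hc (n + 1) IsVtx.root
    simpa using inv_le_of_estimator (lik_succ_pos hθ n IsVtx.root) (sum_lik c θ (n + 1) [])
      (inv_pos.2 hp) hz ε
  have hlim : Filter.Tendsto (fun ε : ℝ => (Real.exp ε - 1) ^ 2)
      (nhdsWithin 0 (Set.Ioi 0)) (nhds 0) := by
    have : Continuous fun ε : ℝ => (Real.exp ε - 1) ^ 2 := by fun_prop
    simpa using (this.tendsto 0).mono_left nhdsWithin_le_nhds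
  have h0 : limProb c θ [] ≤ 0 := ge_of_tendsto hlim (eventually_nhdsWithin_of_forall hle)
  have hS := limCond_nonneg c θ []
  have e := h0.antisymm (limProb_nonneg c θ [])
  rw [limProb_eq, div_eq_zero_iff] at e
  exact e.resolve_right (by linarith)

lemma tendsto_deviation {κ : ℝ} (hκ : 0 < κ)
    (hθ : ∀ v, IsVtx c v → v ≠ [] → 0 < θ v ∧ θ v < 1 ∧ 2 * κ ≤ 1 - θ v ^ 2)
    (h : limCond c θ [] = 0) {ε : ℝ} (hε : 0 < ε) :
    Filter.Tendsto (fun n => deviation (lik c θ (n + 1) []) ε) Filter.atTop (nhds 0) := by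
  have hpos := fun n => lik_succ_pos (fun v hv hne => ⟨(hθ v hv hne).1, (hθ v hv hne).2.1⟩) n
    (IsVtx.root (c := c))
  have hA : 0 < (1 - Real.exp (-(ε / 2))) ^ 2 := by
    have : Real.exp (-(ε / 2)) < 1 := Real.exp_lt_one_iff.2 (by linarith)
    exact pow_pos (sub_pos.2 this) 2
  have hlim : Filter.Tendsto (fun n => 2 * (1 - Real.exp (-(levelCond c θ n [] / κ))) /
      (1 - Real.exp (-(ε / 2))) ^ 2) Filter.atTop (nhds 0) := by
    have h1 := (tendsto_levelCond c θ []).div_const κ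
    rw [h, zero_div] at h1
    have h2 := (Real.continuous_exp.tendsto _).comp h1.neg
    simpa using ((h2.const_sub 1).const_mul 2).div_const ((1 - Real.exp (-(ε / 2))) ^ 2)
  refine squeeze_zero (fun n => deviation_nonneg (hpos n) ε) (fun n => ?_) hlim
  rw [le_div_iff₀' hA]
  have hd := deviation_le (hpos n) (sum_lik c θ (n + 1) []) hε
  have hd0 := mul_nonneg hA.le (deviation_nonneg (hpos n) ε)
  have ha := exp_neg_le_affinity_sq hκ hθ n IsVtx.root
  have h0 := affinity_nonneg (lik c θ (n + 1) [])
  nlinarith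

end Criterion

lemma tanh_le_tanh {x y : ℝ} (h : x ≤ y) : Real.tanh x ≤ Real.tanh y := by
  have hmem : ∀ x, Real.tanh x ∈ Set.Ioo (-1) 1 := fun x =>
    ⟨Real.neg_one_lt_tanh x, Real.tanh_lt_one x⟩
  rwa [← Real.artanh_le_artanh_iff (hmem x) (hmem y), Real.artanh_tanh, Real.artanh_tanh]

lemma tanh_pos {x : ℝ} (h : 0 < x) : 0 < Real.tanh x := by
  rw [Real.tanh_eq_sinh_div_cosh]
  exact div_pos (Real.sinh_pos_iff.2 h) (Real.cosh_pos x)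

theorem stmt1 (c : Vtx → ℕ) (J : Vtx → ℝ) (β Jmin Jmax : ℝ)
    (hβ : 0 < β) (hJmin : 0 < Jmin)
    (hJ : ∀ v, IsVtx c v → v ≠ [] → Jmin ≤ J v ∧ J v ≤ Jmax)
    (hleafless : ∀ v, IsVtx c v → 1 ≤ c v) :
    (∀ ε : ℝ, 0 < ε →
        Filter.Tendsto (fun N : ℕ =>
          (∑ σ : Conf c N, if ε < |XoOf c J β N σ| then wt c J β N σ else 0) /
          (∑ σ : Conf c N, wt c J β N σ)) Filter.atTop (nhds 0)) ↔
      capInf c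
        (fun v => (∏ k ∈ Finset.range v.length,
          (ENNReal.ofReal (Real.tanh (β * J (v.take (k + 1))))) ^ 2)⁻¹) 2 = 0 := by
  set θ : Vtx → ℝ := fun v => Real.tanh (β * J v)
  set κ : ℝ := (1 - Real.tanh (β * Jmax) ^ 2) / 2 with hκd
  have hκ : 0 < κ := half_pos (sub_pos.2 (Real.tanh_sq_lt_one _))
  have hθ : ∀ v, IsVtx c v → v ≠ [] → 0 < θ v ∧ θ v < 1 ∧ 2 * κ ≤ 1 - θ v ^ 2 := by
    intro v hv hne
    obtain ⟨h1, h2⟩ := hJ v hv hne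
    have hpos : 0 < θ v := tanh_pos (mul_pos hβ (hJmin.trans_le h1))
    have hle : θ v ≤ Real.tanh (β * Jmax) := tanh_le_tanh (mul_le_mul_of_nonneg_left h2 hβ.le)
    have hsq := pow_le_pow_left₀ hpos.le hle 2
    exact ⟨hpos, Real.tanh_lt_one _, by linarith⟩
  refine Iff.trans ?_ (capInf_eq_zero_iff (fun v hv hne => (hθ v hv hne).1) hleafless).symm
  simp only [expectation_eq_deviation]
  constructor
  · intro h
    exact limCond_eq_zero_of_tendsto (fun v hv hne => ⟨(hθ v hv hne).1, (hθ v hv hne).2.1⟩)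
      hleafless fun ε hε => (Filter.tendsto_add_atTop_iff_nat 1).2 (h ε hε)
  · intro h ε hε
    exact (Filter.tendsto_add_atTop_iff_nat 1).1 (tendsto_deviation hκ hθ h hε)
end
end
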